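/- Let p, q be probability measures on ℝ^d, let α ∈ (0,1), and assume c = ∫_0^∞ sup_{x∈ℝ^d} ⟨φ(x), (Σ_p + βI)^{-1} φ(x)⟩_H² dβ is finite. Let p̂ and q̂ be empirical measures supported on n and m i.i.d. samples from p and q respectively. Then, without assuming p absolutely continuous with respect to q, E| KKL_α(p̂||q̂) − KKL_α(p||q) | ≤ (32/(α √(m∧n))) · (2√c + log n) + (2/(m∧n)) · ( 1/α + (c (26 log n)²/α²) (1 + n/(m∧n)) ). -/

import Mathlib

open MeasureTheory RealInnerProductSpace
open scoped ENNReal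

noncomputable section

universe u

/-- Rank-one operator `u v^*` : `f ↦ ⟪v, f⟫ • u`. -/
def rankOne {H : Type u} [NormedAddCommGroup H] [InnerProductSpace ℝ H] (u v : H) :
    H →L[ℝ] H := (innerSL ℝ v).smulRight u

/-- Covariance operator `Σ_p = ∫ φ(x) ⊗ φ(x) dp(x)`. -/
def covOp {d : ℕ} {H : Type u} [NormedAddCommGroup H] [InnerProductSpace ℝ H]
    [CompleteSpace H] (φ : EuclideanSpace ℝ (Fin d) → H)
    (p : Measure (EuclideanSpace ℝ (Fin d))) : H →L[ℝ] H :=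
  ∫ x, rankOne (φ x) (φ x) ∂p

/-- The empirical measure `(1/n) ∑ᵢ δ_{x_i}`. -/
def empMeas {d n : ℕ} (xs : Fin n → EuclideanSpace ℝ (Fin d)) :
    Measure (EuclideanSpace ℝ (Fin d)) :=
  (n : ℝ≥0∞)⁻¹ • ∑ i, Measure.dirac (xs i)

/-- `v` is the value of the regularized divergence
`KKL_α(p‖q) = Tr(Σ_p log Σ_p) - Tr(Σ_p log(αΣ_p + (1-α)Σ_q))`, expressed through
spectral decompositions of `Σ_p` and `αΣ_p + (1-α)Σ_q`. -/
def IsKKLa {d : ℕ} {H : Type u} [NormedAddCommGroup H] [InnerProductSpace ℝ H]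
    [CompleteSpace H] (φ : EuclideanSpace ℝ (Fin d) → H) (α : ℝ)
    (p q : Measure (EuclideanSpace ℝ (Fin d))) (v : ℝ) : Prop :=
  ∃ (ι : Type u) (f : HilbertBasis ι ℝ H) (lam : ι → ℝ)
    (g : HilbertBasis ι ℝ H) (gam : ι → ℝ),
    (∀ i, covOp φ p (f i) = lam i • f i) ∧ (∀ i, 0 ≤ lam i) ∧
    (∀ j, (α • covOp φ p + (1 - α) • covOp φ q) (g j) = gam j • g j) ∧ (∀ j, 0 ≤ gam j) ∧
    Summable (fun ij : ι × ι =>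
      lam ij.1 * Real.log (lam ij.1 / gam ij.2) * ⟪(f ij.1 : H), (g ij.2 : H)⟫ ^ 2) ∧
    v = ∑' ij : ι × ι,
      lam ij.1 * Real.log (lam ij.1 / gam ij.2) * ⟪(f ij.1 : H), (g ij.2 : H)⟫ ^ 2


section Resolvent

variable {H : Type u} [NormedAddCommGroup H] [InnerProductSpace ℝ H]

/-- Positive semidefinite bounded operator. -/
structure Psd (X : H →L[ℝ] H) : Prop where
  sym : ∀ u v, ⟪X u, v⟫ = ⟪u, X v⟫
  nonneg : ∀ v, 0 ≤ ⟪v, X v⟫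

/-- The resolvent `(X + β)⁻¹`. -/
def rs (X : H →L[ℝ] H) (β : ℝ) : H →L[ℝ] H := Ring.inverse (X + β • 1)

theorem Psd.smul {X : H →L[ℝ] H} (h : Psd X) {a : ℝ} (ha : 0 ≤ a) : Psd (a • X) where
  sym u v := by simp [inner_smul_left, inner_smul_right, h.sym]
  nonneg v := by
    simp only [_root_.smul_apply, inner_smul_right]
    exact mul_nonneg ha (h.nonneg v)

theorem Psd.add {X Y : H →L[ℝ] H} (h : Psd X) (h' : Psd Y) : Psd (X + Y) where
  sym u v := by simp [inner_add_left, inner_add_right, h.sym, h'.sym]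
  nonneg v := by
    simp only [_root_.add_apply, inner_add_right]
    exact add_nonneg (h.nonneg v) (h'.nonneg v)

variable [CompleteSpace H]

theorem rs_isUnit {X : H →L[ℝ] H} (h : Psd X) {β : ℝ} (hβ : 0 < β) :
    IsUnit (X + β • (1 : H →L[ℝ] H)) := by
  refine ContinuousLinearMap.isUnit_of_forall_le_norm_inner_map _ (c := ⟨β, hβ.le⟩) hβ ?_
  intro x
  have h1 := h.nonneg x
  have : ⟪(X + β • (1 : H →L[ℝ] H)) x, x⟫ = ⟪x, X x⟫ + β * ‖x‖ ^ 2 := by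
    simp [inner_add_left, inner_smul_left, h.sym]
  rw [this]
  refine le_trans ?_ (le_abs_self _)
  change ‖x‖ ^ 2 * β ≤ _
  nlinarith

theorem rs_right {X : H →L[ℝ] H} (h : Psd X) {β : ℝ} (hβ : 0 < β) (v : H) :
    X (rs X β v) + β • rs X β v = v := by
  have := Ring.mul_inverse_cancel _ (rs_isUnit h hβ)
  have := congrArg (fun T : H →L[ℝ] H => T v) this
  simpa [rs] using this

theorem rs_left {X : H →L[ℝ] H} (h : Psd X) {β : ℝ} (hβ : 0 < β) (v : H) :
    rs X β (X v + β • v) = v := by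
  have := Ring.inverse_mul_cancel _ (rs_isUnit h hβ)
  have := congrArg (fun T : H →L[ℝ] H => T v) this
  simpa [rs] using this

theorem rs_eq_of {X : H →L[ℝ] H} (h : Psd X) {β : ℝ} (hβ : 0 < β) {v w : H}
    (hw : X w + β • w = v) : rs X β v = w := by
  rw [← hw, rs_left h hβ]

theorem rs_sym {X : H →L[ℝ] H} (h : Psd X) {β : ℝ} (hβ : 0 < β) (u v : H) :
    ⟪rs X β u, v⟫ = ⟪u, rs X β v⟫ := by
  conv_lhs => rw [← rs_right h hβ v]
  conv_rhs => rw [← rs_right h hβ u]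
  simp [inner_add_left, inner_add_right, inner_smul_left, inner_smul_right, h.sym]

/-- `⟪v, R v⟫ = ⟪R v, X R v⟫ + β ‖R v‖²`. -/
theorem rs_quad {X : H →L[ℝ] H} (h : Psd X) {β : ℝ} (hβ : 0 < β) (v : H) :
    ⟪v, rs X β v⟫ = ⟪rs X β v, X (rs X β v)⟫ + β * ‖rs X β v‖ ^ 2 := by
  have h1 := rs_right h hβ v
  generalize rs X β v = z at h1 ⊢
  rw [← h1]
  simp [inner_add_left, inner_smul_left, h.sym]

theorem rs_psd {X : H →L[ℝ] H} (h : Psd X) {β : ℝ} (hβ : 0 < β) : Psd (rs X β) where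
  sym := rs_sym h hβ
  nonneg v := by
    rw [rs_quad h hβ]
    have := h.nonneg (rs X β v)
    positivity

theorem rs_norm_le {X : H →L[ℝ] H} (h : Psd X) {β : ℝ} (hβ : 0 < β) (v : H) :
    ‖rs X β v‖ ≤ ‖v‖ / β := by
  have h1 := rs_quad h hβ v
  have h2 := h.nonneg (rs X β v)
  have h3 := real_inner_le_norm v (rs X β v)
  rw [le_div_iff₀ hβ]
  rcases (norm_nonneg (rs X β v)).eq_or_lt with h0 | h0
  · rw [← h0]; simp
  · have : (‖rs X β v‖ * β) * ‖rs X β v‖ ≤ ‖v‖ * ‖rs X β v‖ := by nlinarith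
    exact le_of_mul_le_mul_right this h0

theorem rs_opNorm_le {X : H →L[ℝ] H} (h : Psd X) {β : ℝ} (hβ : 0 < β) :
    ‖rs X β‖ ≤ 1 / β := by
  refine ContinuousLinearMap.opNorm_le_bound _ (by positivity) fun v => ?_
  have := rs_norm_le h hβ v
  rwa [one_div, inv_mul_eq_div]

theorem rs_quad_le {X : H →L[ℝ] H} (h : Psd X) {β : ℝ} (hβ : 0 < β) (v : H) :
    ⟪v, rs X β v⟫ ≤ ‖v‖ ^ 2 / β := by
  have h1 := real_inner_le_norm v (rs X β v)
  have h2 := rs_norm_le h hβ v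
  calc _ ≤ ‖v‖ * ‖rs X β v‖ := h1
    _ ≤ ‖v‖ * (‖v‖ / β) := by gcongr
    _ = _ := by ring

theorem rs_quad_le' {X : H →L[ℝ] H} (h : Psd X) {β : ℝ} (hβ : 0 < β) (v : H) :
    ⟪rs X β v, X (rs X β v)⟫ ≤ ⟪v, rs X β v⟫ := by
  rw [rs_quad h hβ]
  have : 0 ≤ β * ‖rs X β v‖ ^ 2 := by positivity
  linarith

/-- Variational lower bound. -/
theorem rs_var {X : H →L[ℝ] H} (h : Psd X) {β : ℝ} (hβ : 0 < β) (v w : H) :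
    2 * ⟪w, v⟫ - ⟪w, X w⟫ - β * ‖w‖ ^ 2 ≤ ⟪v, rs X β v⟫ := by
  set z := rs X β v with hz
  have h1 : X z + β • z = v := rs_right h hβ v
  have h2 := h.nonneg (w - z)
  have h3 : 0 ≤ β * ‖w - z‖ ^ 2 := by positivity
  rw [norm_sub_sq_real] at h3
  simp only [map_sub, inner_sub_left, inner_sub_right] at h2
  have h4 : ⟪z, X w⟫ = ⟪w, X z⟫ := by rw [← h.sym, real_inner_comm]
  have h5 : ⟪w, v⟫ = ⟪w, X z⟫ + β * ⟪w, z⟫ := by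
    rw [← h1]; simp [inner_add_right, inner_smul_right]
  have h6 : ⟪v, z⟫ = ⟪z, X z⟫ + β * ‖z‖ ^ 2 := rs_quad h hβ v
  rw [h5, h6]
  nlinarith

theorem rs_anti {X Y : H →L[ℝ] H} (h : Psd X) (h' : Psd Y) (hXY : ∀ v, ⟪v, X v⟫ ≤ ⟪v, Y v⟫)
    {β : ℝ} (hβ : 0 < β) (v : H) : ⟪v, rs Y β v⟫ ≤ ⟪v, rs X β v⟫ := by
  have h1 := rs_var h hβ v (rs Y β v)
  have h2 := rs_quad h' hβ v
  have h3 := hXY (rs Y β v)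
  rw [real_inner_comm v (rs Y β v)] at *
  linarith

theorem rs_eigen {X : H →L[ℝ] H} (h : Psd X) {β : ℝ} (hβ : 0 < β) {g : H} {γ : ℝ}
    (hγ : 0 ≤ γ) (hg : X g = γ • g) : rs X β g = (γ + β)⁻¹ • g := by
  apply rs_eq_of h hβ
  rw [map_smul, hg, smul_smul, smul_smul, ← add_smul]
  have : (γ + β)⁻¹ * γ + β * (γ + β)⁻¹ = 1 := by
    have : γ + β ≠ 0 := by positivity
    field_simp
  rw [this, one_smul]

theorem rs_diff {X Y : H →L[ℝ] H} (h : Psd X) (h' : Psd Y) {β : ℝ} (hβ : 0 < β) (v : H) :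
    rs Y β v = rs X β v + rs X β ((X - Y) (rs Y β v)) := by
  have h1 := rs_right h' hβ v
  conv_rhs => enter [1]; rw [← h1]
  rw [← map_add]
  have : Y (rs Y β v) + β • rs Y β v + (X - Y) (rs Y β v)
      = X (rs Y β v) + β • rs Y β v := by
    simp only [_root_.sub_apply]; abel
  rw [this, rs_left h hβ]

theorem rs_diff' {X Y : H →L[ℝ] H} (h : Psd X) (h' : Psd Y) {β : ℝ} (hβ : 0 < β) (v : H) :
    rs Y β v = rs X β v + rs Y β ((X - Y) (rs X β v)) := by
  have := rs_diff h' h hβ v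
  have e : (X - Y) (rs X β v) = - ((Y - X) (rs X β v)) := by simp
  rw [e, map_neg]
  rw [← sub_eq_add_neg, eq_sub_iff_add_eq]
  exact this.symm

theorem rs_smul {X : H →L[ℝ] H} (h : Psd X) {a β : ℝ} (ha : 0 < a) (hβ : 0 < β) (v : H) :
    rs (a • X) β v = a⁻¹ • rs X (β / a) v := by
  apply rs_eq_of (h.smul ha.le) hβ
  have := rs_right h (div_pos hβ ha) v
  conv_rhs => rw [← this]
  simp only [_root_.smul_apply, map_smul, smul_smul]
  rw [inv_mul_cancel₀ ha.ne', one_smul, div_eq_mul_inv]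

theorem rs_continuousOn {Z : Type*} [TopologicalSpace Z] (X : Z → H →L[ℝ] H)
    (hX : Continuous X) (hpsd : ∀ z, Psd (X z)) :
    ContinuousOn (fun zb : Z × ℝ => rs (X zb.1) zb.2) (Set.univ ×ˢ Set.Ioi 0) := by
  intro zb hzb
  apply ContinuousAt.continuousWithinAt
  have hb : 0 < zb.2 := hzb.2
  obtain ⟨U, hU⟩ := rs_isUnit (hpsd zb.1) hb
  have h1 := NormedRing.inverse_continuousAt U
  have h2 : ContinuousAt (fun zb : Z × ℝ => X zb.1 + zb.2 • (1 : H →L[ℝ] H)) zb := by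
    have : Continuous (fun zb : Z × ℝ => X zb.1 + zb.2 • (1 : H →L[ℝ] H)) := by fun_prop
    exact this.continuousAt
  rw [hU] at h1
  exact ContinuousAt.comp (f := fun zb : Z × ℝ => X zb.1 + zb.2 • (1 : H →L[ℝ] H)) h1 h2

end Resolvent

section Cov

variable {d : ℕ} {H : Type u} [NormedAddCommGroup H] [InnerProductSpace ℝ H]

theorem rankOne_apply (u v f : H) : rankOne u v f = ⟪v, f⟫ • u := by
  simp [rankOne]

theorem rankOne_continuous {φ : EuclideanSpace ℝ (Fin d) → H} (hφc : Continuous φ) :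
    Continuous fun x => rankOne (φ x) (φ x) := by
  have : (fun x => rankOne (φ x) (φ x))
      = fun x => ContinuousLinearMap.smulRightL ℝ H H (innerSL ℝ (φ x)) (φ x) := by
    ext x v; simp [rankOne]
  rw [this]
  fun_prop

theorem rankOne_norm_le {u : H} (hu : ‖u‖ = 1) : ‖rankOne u u‖ ≤ 1 := by
  refine ContinuousLinearMap.opNorm_le_bound _ zero_le_one fun v => ?_
  rw [rankOne_apply, norm_smul, hu, mul_one, one_mul]
  simpa [hu] using norm_inner_le_norm (𝕜 := ℝ) u v

theorem bcint {E : Type*} [NormedAddCommGroup E] {Z : Type*} [TopologicalSpace Z]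
    [SecondCountableTopology Z] [MeasurableSpace Z] [OpensMeasurableSpace Z]
    [TopologicalSpace.PseudoMetrizableSpace Z]
    {P : Measure Z} [IsFiniteMeasure P]
    {F : Z → E} (hF : Continuous F) (C : ℝ) (hC : ∀ x, ‖F x‖ ≤ C) :
    Integrable F P :=
  Integrable.of_bound hF.aestronglyMeasurable C (ae_of_all _ hC)

variable [CompleteSpace H]
variable {φ : EuclideanSpace ℝ (Fin d) → H} (hφc : Continuous φ) (hφ1 : ∀ x, ‖φ x‖ = 1)
variable (P : Measure (EuclideanSpace ℝ (Fin d))) [IsProbabilityMeasure P]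

theorem rankOne_integrable (hφc : Continuous φ) (hφ1 : ∀ x, ‖φ x‖ = 1) :
    Integrable (fun x => rankOne (φ x) (φ x)) P :=
  bcint (rankOne_continuous hφc) 1 fun x => rankOne_norm_le (hφ1 x)

theorem abs_inner_phi_le (hφ1 : ∀ x, ‖φ x‖ = 1) (x : EuclideanSpace ℝ (Fin d)) (v : H) :
    |⟪φ x, v⟫| ≤ ‖v‖ := by
  simpa [hφ1 x] using abs_real_inner_le_norm (φ x) v

theorem covOp_apply (hφc : Continuous φ) (hφ1 : ∀ x, ‖φ x‖ = 1) (v : H) :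
    covOp φ P v = ∫ x, ⟪φ x, v⟫ • φ x ∂P := by
  have h := (ContinuousLinearMap.apply ℝ H v).integral_comp_comm (rankOne_integrable P hφc hφ1)
  rw [covOp]
  simp only [ContinuousLinearMap.apply_apply, rankOne_apply] at h
  exact h.symm

theorem covOp_apply_integrable (hφc : Continuous φ) (hφ1 : ∀ x, ‖φ x‖ = 1) (v : H) :
    Integrable (fun x => ⟪φ x, v⟫ • φ x) P :=
  bcint (by fun_prop) ‖v‖ fun x => by
    rw [norm_smul, hφ1, mul_one]; exact abs_inner_phi_le hφ1 x v

theorem covOp_inner (hφc : Continuous φ) (hφ1 : ∀ x, ‖φ x‖ = 1) (u v : H) :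
    ⟪u, covOp φ P v⟫ = ∫ x, ⟪φ x, u⟫ * ⟪φ x, v⟫ ∂P := by
  rw [covOp_apply P hφc hφ1, ← integral_inner (covOp_apply_integrable P hφc hφ1 v)]
  congr 1; ext x
  rw [inner_smul_right, real_inner_comm u, mul_comm]

theorem covOp_psd (hφc : Continuous φ) (hφ1 : ∀ x, ‖φ x‖ = 1) : Psd (covOp φ P) where
  sym u v := by
    rw [real_inner_comm, covOp_inner P hφc hφ1, covOp_inner P hφc hφ1]
    congr 1; ext x; ring
  nonneg v := by
    rw [covOp_inner P hφc hφ1]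
    exact integral_nonneg fun x => mul_self_nonneg _

theorem covOp_quad (hφc : Continuous φ) (hφ1 : ∀ x, ‖φ x‖ = 1) (v : H) :
    ⟪v, covOp φ P v⟫ = ∫ x, ⟪φ x, v⟫ ^ 2 ∂P := by
  rw [covOp_inner P hφc hφ1]; simp only [pow_two]

theorem integral_le_of_le {f : EuclideanSpace ℝ (Fin d) → ℝ} {C : ℝ} (hC : 0 ≤ C)
    (h : ∀ x, f x ≤ C) : ∫ x, f x ∂P ≤ C := by
  by_cases hf : Integrable f P
  · calc ∫ x, f x ∂P ≤ ∫ _, C ∂P := integral_mono hf (integrable_const _) h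
      _ = C := by simp
  · rwa [integral_undef hf]

theorem covOp_quad_le (hφc : Continuous φ) (hφ1 : ∀ x, ‖φ x‖ = 1) (v : H) :
    ⟪v, covOp φ P v⟫ ≤ ‖v‖ ^ 2 := by
  rw [covOp_quad P hφc hφ1]
  apply integral_le_of_le P (by positivity)
  intro x
  have := abs_inner_phi_le hφ1 x v
  rw [← sq_abs]; gcongr

theorem empMeas_prob {n : ℕ} (hn : 0 < n) (xs : Fin n → EuclideanSpace ℝ (Fin d)) :
    IsProbabilityMeasure (empMeas xs) := by
  constructor
  have : (n : ℝ≥0∞) ≠ 0 := by exact_mod_cast hn.ne'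
  simp [empMeas, ENNReal.inv_mul_cancel this (ENNReal.natCast_ne_top n)]

theorem empMeas_integral {n : ℕ} {E : Type*} [NormedAddCommGroup E] [NormedSpace ℝ E]
    [CompleteSpace E] (xs : Fin n → EuclideanSpace ℝ (Fin d))
    (F : EuclideanSpace ℝ (Fin d) → E) :
    ∫ x, F x ∂(empMeas xs) = (n : ℝ)⁻¹ • ∑ i, F (xs i) := by
  rw [empMeas, integral_smul_measure, integral_finsetSum_measure]
  · simp [integral_dirac]
  · intro i _; exact integrable_dirac (by simp)

theorem covOp_emp {n : ℕ} (xs : Fin n → EuclideanSpace ℝ (Fin d)) :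
    covOp φ (empMeas xs) = (n : ℝ)⁻¹ • ∑ i, rankOne (φ (xs i)) (φ (xs i)) := by
  rw [covOp, empMeas_integral]

theorem covOp_emp_continuous {n : ℕ} (hφc : Continuous φ) :
    Continuous fun xs : Fin n → EuclideanSpace ℝ (Fin d) => covOp φ (empMeas xs) := by
  simp only [covOp_emp]
  have := rankOne_continuous hφc
  have h2 : ∀ i, Continuous fun xs : Fin n → EuclideanSpace ℝ (Fin d) =>
      rankOne (φ (xs i)) (φ (xs i)) := fun i => by
    have h2 : Continuous fun xs : Fin n → EuclideanSpace ℝ (Fin d) => xs i := by fun_prop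
    exact this.comp h2
  fun_prop

/-- countably many basis vectors matter -/
theorem exists_countable_supp {ι : Type*} (hφc : Continuous φ) (g : HilbertBasis ι ℝ H) :
    ∃ J : Set ι, J.Countable ∧ ∀ j ∉ J, ∀ x, ⟪φ x, g j⟫ = 0 := by
  let D := TopologicalSpace.denseSeq (EuclideanSpace ℝ (Fin d))
  refine ⟨⋃ k, {j | ⟪φ (D k), g j⟫ ≠ 0}, ?_, ?_⟩
  · refine Set.countable_iUnion fun k => ?_
    have := (g.hasSum_inner_mul_inner (φ (D k)) (φ (D k))).summable.countable_support
    refine this.mono fun j hj => ?_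
    simp only [Function.mem_support, ne_eq, mul_eq_zero, not_or]
    refine ⟨hj, ?_⟩
    rw [real_inner_comm]; exact hj
  · intro j hj
    simp only [Set.mem_iUnion, Set.mem_ofPred_eq, not_exists, not_not] at hj
    have h1 : Continuous fun x => ⟪φ x, g j⟫ := by fun_prop
    have := (TopologicalSpace.denseRange_denseSeq (EuclideanSpace ℝ (Fin d))).equalizer h1
      (continuous_const (y := (0:ℝ))) (funext hj)
    exact fun x => congrFun this x

theorem quad_integrable (hφc : Continuous φ) (hφ1 : ∀ x, ‖φ x‖ = 1) (X : H →L[ℝ] H) :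
    Integrable (fun x => ⟪φ x, X (φ x)⟫) P := by
  refine bcint (by fun_prop) ‖X‖ fun x => ?_
  refine (norm_inner_le_norm _ _).trans ?_
  rw [hφ1, one_mul]
  exact (X.le_opNorm _).trans (by rw [hφ1, mul_one])

theorem basis_sq_hasSum {ι : Type*} (g : HilbertBasis ι ℝ H) (v : H) :
    HasSum (fun j => ⟪g j, v⟫ ^ 2) (‖v‖ ^ 2) := by
  have := g.hasSum_inner_mul_inner v v
  rw [real_inner_self_eq_norm_sq] at this
  have e : (fun j => ⟪g j, v⟫ ^ 2) = fun i => ⟪v, g i⟫ * ⟪g i, v⟫ := by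
    ext j
    rw [real_inner_comm v, pow_two]
  rw [e]; exact this

/-- Trace formula: `Tr (X Σ_P) = ∫ ⟪φ, X φ⟫ dP`. -/
theorem trace_hasSum {ι : Type*} (hφc : Continuous φ) (hφ1 : ∀ x, ‖φ x‖ = 1)
    (g : HilbertBasis ι ℝ H) (X : H →L[ℝ] H) :
    HasSum (fun j => ⟪g j, X (covOp φ P (g j))⟫) (∫ x, ⟪φ x, X (φ x)⟫ ∂P) := by
  obtain ⟨J, hJ, hJ0⟩ := exists_countable_supp hφc g
  have : Countable J := hJ
  have key : ∀ j, ⟪g j, X (covOp φ P (g j))⟫ = ∫ x, ⟪φ x, g j⟫ * ⟪g j, X (φ x)⟫ ∂P := by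
    intro j
    have hi := covOp_apply_integrable P hφc hφ1 (g j)
    rw [covOp_apply P hφc hφ1, ← X.integral_comp_comm hi,
      ← integral_inner (X.integrable_comp hi)]
    congr 1; ext x
    simp [inner_smul_right]
  simp only [key]
  rw [← hasSum_subtype_iff_of_support_subset (s := J)]
  swap
  · intro j hj
    by_contra hjJ
    apply hj
    simp [hJ0 j hjJ]
  have hb : ∀ x, HasSum (fun j => (⟪g j, φ x⟫ ^ 2 + ⟪g j, X (φ x)⟫ ^ 2) / 2)
      ((‖φ x‖ ^ 2 + ‖X (φ x)‖ ^ 2) / 2) := fun x =>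
    ((basis_sq_hasSum g _).add (basis_sq_hasSum g _)).div_const _
  have hXc : Continuous fun x => X (φ x) := by fun_prop
  refine hasSum_integral_of_dominated_convergence
    (fun j x => (⟪g j, φ x⟫ ^ 2 + ⟪g j, X (φ x)⟫ ^ 2) / 2) ?_ ?_ ?_ ?_ ?_
  · intro j
    exact Continuous.aestronglyMeasurable (by fun_prop)
  · intro j
    refine ae_of_all _ fun x => ?_
    rw [Real.norm_eq_abs, abs_mul, ← sq_abs ⟪g j, φ x⟫, ← sq_abs ⟪g j, X (φ x)⟫,
      real_inner_comm (φ x) (g j)]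
    nlinarith [sq_nonneg (|⟪φ x, g j⟫| - |⟪g j, X (φ x)⟫|), sq_nonneg (|⟪g j, φ x⟫| - |⟪g j, X (φ x)⟫|)]
  · exact ae_of_all _ fun x => (hb x).summable.subtype _
  · refine Integrable.mono' (g := fun x => (1 + ‖X‖ ^ 2) / 2) (integrable_const _) ?_ ?_
    · apply Measurable.aestronglyMeasurable
      have hm : ∀ j : J, Measurable fun x =>
          ENNReal.ofReal ((⟪g j, φ x⟫ ^ 2 + ⟪g j, X (φ x)⟫ ^ 2) / 2) := fun j => by
        have : Continuous fun x => ((⟪g j, φ x⟫ ^ 2 + ⟪g j, X (φ x)⟫ ^ 2) / 2) := by fun_prop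
        exact this.measurable.ennreal_ofReal
      have e : (fun x => ∑' j : J, ((⟪g j, φ x⟫ ^ 2 + ⟪g j, X (φ x)⟫ ^ 2) / 2))
        = fun x => (∑' j : J,
          ENNReal.ofReal ((⟪g j, φ x⟫ ^ 2 + ⟪g j, X (φ x)⟫ ^ 2) / 2)).toReal := by
        ext x
        have hs : Summable fun j : J => ((⟪g j, φ x⟫ ^ 2 + ⟪g j, X (φ x)⟫ ^ 2) / 2) :=
          (hb x).summable.subtype _
        rw [← ENNReal.ofReal_tsum_of_nonneg (fun j => by positivity) hs]
        rw [ENNReal.toReal_ofReal]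
        exact tsum_nonneg fun j => by positivity
      rw [e]
      exact (Measurable.tsum hm).ennreal_toReal
    · refine ae_of_all _ fun x => ?_
      have h0 : ∀ j, 0 ≤ (⟪g j, φ x⟫ ^ 2 + ⟪g j, X (φ x)⟫ ^ 2) / 2 := fun j => by positivity
      rw [Real.norm_eq_abs, abs_of_nonneg (tsum_nonneg fun j : J => h0 j)]
      refine (Summable.tsum_subtype_le (fun j =>
        (⟪g j, φ x⟫ ^ 2 + ⟪g j, X (φ x)⟫ ^ 2) / 2) J h0 (hb x).summable).trans ?_
      rw [(hb x).tsum_eq, hφ1]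
      have : ‖X (φ x)‖ ≤ ‖X‖ := (X.le_opNorm _).trans (by rw [hφ1, mul_one])
      have : ‖X (φ x)‖ ^ 2 ≤ ‖X‖ ^ 2 := by gcongr
      linarith
  · refine ae_of_all _ fun x => ?_
    refine (hasSum_subtype_iff_of_support_subset (s := J)
      (f := fun j => ⟪φ x, g j⟫ * ⟪g j, X (φ x)⟫) ?_).2 (g.hasSum_inner_mul_inner _ _)
    intro j hj
    by_contra hjJ
    apply hj
    simp [hJ0 j hjJ]

end Cov

section KKL

theorem log_integral_aux {l γ : ℝ} (hl : 0 < l) (hγ : 0 < γ) (h : γ ≤ l) :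
    IntegrableOn (fun β : ℝ => (γ + β)⁻¹ - (l + β)⁻¹) (Set.Ioi 0) ∧
    ∫ β in Set.Ioi (0:ℝ), ((γ + β)⁻¹ - (l + β)⁻¹) = Real.log (l / γ) := by
  have hd : ∀ x ∈ Set.Ici (0:ℝ), HasDerivAt (fun β => Real.log (γ + β) - Real.log (l + β))
      ((γ + x)⁻¹ - (l + x)⁻¹) x := by
    intro x hx
    have hx : 0 ≤ x := hx
    have h1 : HasDerivAt (fun β => γ + β) 1 x := (hasDerivAt_id x).const_add γ
    have h2 : HasDerivAt (fun β => l + β) 1 x := (hasDerivAt_id x).const_add l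
    have h1' := h1.log (by positivity)
    have h2' := h2.log (by positivity)
    exact (h1'.sub h2').congr_deriv (by simp)
  have hn : ∀ x ∈ Set.Ioi (0:ℝ), 0 ≤ (γ + x)⁻¹ - (l + x)⁻¹ := by
    intro x hx
    have hx : 0 < x := hx
    rw [sub_nonneg]
    gcongr
  have ht : Filter.Tendsto (fun β => Real.log (γ + β) - Real.log (l + β)) Filter.atTop
      (nhds 0) := by
    have h1 : Filter.Tendsto (fun β : ℝ => (γ + β) / (l + β)) Filter.atTop (nhds 1) := by
      have h0 : Filter.Tendsto (fun β : ℝ => 1 - (l - γ) * (l + β)⁻¹) Filter.atTop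
          (nhds (1 - (l - γ) * 0)) := by
        refine tendsto_const_nhds.sub (tendsto_const_nhds.mul ?_)
        exact tendsto_inv_atTop_zero.comp (Filter.tendsto_atTop_add_const_left _ _ Filter.tendsto_id)
      rw [mul_zero, sub_zero] at h0
      refine h0.congr' ?_
      filter_upwards [Filter.eventually_gt_atTop 0] with β hβ
      have : l + β ≠ 0 := by positivity
      field_simp; ring
    have h2 := (Real.continuousAt_log (one_ne_zero)).tendsto.comp h1
    rw [Real.log_one] at h2
    refine h2.congr' ?_
    filter_upwards [Filter.eventually_gt_atTop 0] with β hβ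
    simp only [Function.comp]
    rw [Real.log_div (by positivity) (by positivity)]
  have hi := integrableOn_Ioi_deriv_of_nonneg' hd hn ht
  refine ⟨hi, ?_⟩
  rw [integral_Ioi_of_hasDerivAt_of_nonneg' hd hn ht]
  simp only [add_zero]
  rw [Real.log_div hl.ne' hγ.ne']; ring

theorem log_integral {l γ : ℝ} (hl : 0 < l) (hγ : 0 < γ) :
    IntegrableOn (fun β : ℝ => (γ + β)⁻¹ - (l + β)⁻¹) (Set.Ioi 0) ∧
    ∫ β in Set.Ioi (0:ℝ), ((γ + β)⁻¹ - (l + β)⁻¹) = Real.log (l / γ) ∧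
    ∫ β in Set.Ioi (0:ℝ), ‖(γ + β)⁻¹ - (l + β)⁻¹‖ = |Real.log (l / γ)| := by
  have key : ∀ {l γ : ℝ}, 0 < l → 0 < γ → γ ≤ l →
      ∫ β in Set.Ioi (0:ℝ), ‖(γ + β)⁻¹ - (l + β)⁻¹‖ = |Real.log (l / γ)| := by
    intro l γ hl hγ h
    rw [abs_of_nonneg (Real.log_nonneg (by rwa [le_div_iff₀ hγ, one_mul])),
      ← (log_integral_aux hl hγ h).2]
    refine setIntegral_congr_fun measurableSet_Ioi fun x hx => ?_
    have hx : 0 < x := hx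
    refine abs_of_nonneg ?_
    rw [sub_nonneg]; gcongr
  rcases le_total γ l with h | h
  · exact ⟨(log_integral_aux hl hγ h).1, (log_integral_aux hl hγ h).2, key hl hγ h⟩
  · have h1 := log_integral_aux hγ hl h
    have h2 := key hγ hl h
    have e : Real.log (l / γ) = - Real.log (γ / l) := by
      rw [← Real.log_inv, inv_div]
    have e2 : (fun β : ℝ => (γ + β)⁻¹ - (l + β)⁻¹) = fun β => -((l + β)⁻¹ - (γ + β)⁻¹) := by
      ext; ring
    refine ⟨?_, ?_, ?_⟩
    · rw [e2]; exact h1.1.neg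
    · rw [e2, integral_neg, h1.2, e]
    · rw [e, abs_neg, ← h2]
      congr 1; ext; rw [norm_sub_rev]

theorem hasSum_prod_nonneg {ι κ : Type*} {a : ι × κ → ℝ} (ha : ∀ x, 0 ≤ a x) {b : ι → ℝ} {s : ℝ}
    (h1 : ∀ i, HasSum (fun j => a (i, j)) (b i)) (h2 : HasSum b s) : HasSum a s := by
  have hs : Summable a := by
    rw [summable_prod_of_nonneg ha]
    refine ⟨fun i => (h1 i).summable, ?_⟩
    have : (fun x => ∑' y, a (x, y)) = b := funext fun i => (h1 i).tsum_eq
    rw [this]; exact h2.summable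
  have := hs.hasSum.prod_fiberwise h1
  rw [h2.unique this]
  exact hs.hasSum

variable {d : ℕ} {H : Type u} [NormedAddCommGroup H] [InnerProductSpace ℝ H] [CompleteSpace H]

/-- `Tr (X Σ_P)`. -/
def tr (φ : EuclideanSpace ℝ (Fin d) → H) (P : Measure (EuclideanSpace ℝ (Fin d)))
    (X : H →L[ℝ] H) : ℝ := ∫ x, ⟪φ x, X (φ x)⟫ ∂P

/-- mixture operator -/
def mix (φ : EuclideanSpace ℝ (Fin d) → H) (α : ℝ) (P Q : Measure (EuclideanSpace ℝ (Fin d))) :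
    H →L[ℝ] H := α • covOp φ P + (1 - α) • covOp φ Q

variable {φ : EuclideanSpace ℝ (Fin d) → H} (hφc : Continuous φ) (hφ1 : ∀ x, ‖φ x‖ = 1)
variable (P Q : Measure (EuclideanSpace ℝ (Fin d))) [IsProbabilityMeasure P]
  [IsProbabilityMeasure Q]

theorem mix_psd (hφc : Continuous φ) (hφ1 : ∀ x, ‖φ x‖ = 1) {α : ℝ} (h0 : 0 ≤ α) (h1 : α ≤ 1) :
    Psd (mix φ α P Q) :=
  ((covOp_psd P hφc hφ1).smul h0).add ((covOp_psd Q hφc hφ1).smul (by linarith))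

theorem tr_sub (hφc : Continuous φ) (hφ1 : ∀ x, ‖φ x‖ = 1) (X Y : H →L[ℝ] H) :
    tr φ P (X - Y) = tr φ P X - tr φ P Y := by
  rw [tr, tr, tr, ← integral_sub (quad_integrable P hφc hφ1 X) (quad_integrable P hφc hφ1 Y)]
  simp [inner_sub_right]

theorem tr_abs_le (hφ1 : ∀ x, ‖φ x‖ = 1) (X : H →L[ℝ] H) :
    |tr φ P X| ≤ ‖X‖ := by
  have : ∀ x, ‖⟪φ x, X (φ x)⟫‖ ≤ ‖X‖ := fun x => by
    refine (norm_inner_le_norm _ _).trans ?_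
    rw [hφ1, one_mul]
    exact (X.le_opNorm _).trans (by rw [hφ1, mul_one])
  have := norm_integral_le_of_norm_le_const (μ := P) (ae_of_all _ this)
  simpa [tr] using this

theorem tr_continuous (hφc : Continuous φ) (hφ1 : ∀ x, ‖φ x‖ = 1) :
    Continuous (tr φ P) := by
  have : LipschitzWith 1 (tr φ P) := by
    refine LipschitzWith.of_dist_le_mul fun X Y => ?_
    rw [Real.dist_eq, ← tr_sub P hφc hφ1, NNReal.coe_one, one_mul, dist_eq_norm]
    exact tr_abs_le P hφ1 _
  exact this.continuous

theorem rs_continuousOn' {X : H →L[ℝ] H} (h : Psd X) :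
    ContinuousOn (fun β => rs X β) (Set.Ioi 0) := by
  have h1 := rs_continuousOn (fun _ : Unit => X) continuous_const (fun _ => h)
  have h2 : Continuous fun β : ℝ => (((), β) : Unit × ℝ) := by fun_prop
  exact h1.comp h2.continuousOn (fun x hx => ⟨trivial, hx⟩)

theorem kkl_formula (hφc : Continuous φ) (hφ1 : ∀ x, ‖φ x‖ = 1) {α : ℝ} (h0 : 0 < α)
    (h1 : α ≤ 1) {v : ℝ} (hv : IsKKLa φ α P Q v) :
    IntegrableOn (fun β => tr φ P (rs (mix φ α P Q) β) - tr φ P (rs (covOp φ P) β))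
      (Set.Ioi 0) ∧
    v = ∫ β in Set.Ioi (0:ℝ),
      (tr φ P (rs (mix φ α P Q) β) - tr φ P (rs (covOp φ P) β)) := by
  obtain ⟨ι, f, lam, g, gam, hf, hlam, hg, hgam, hsum, rfl⟩ := hv
  have hA := covOp_psd P hφc hφ1
  have hM := mix_psd P Q hφc hφ1 h0.le h1
  have hg' : ∀ j, mix φ α P Q (g j) = gam j • g j := hg
  -- column sums
  have hcol : ∀ j, HasSum (fun i => lam i * ⟪f i, g j⟫ ^ 2) ⟪g j, covOp φ P (g j)⟫ := by
    intro j
    have := f.hasSum_inner_mul_inner (covOp φ P (g j)) (g j)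
    rw [real_inner_comm]
    have e : (fun i => lam i * ⟪f i, g j⟫ ^ 2)
        = fun i => ⟪covOp φ P (g j), f i⟫ * ⟪f i, g j⟫ := by
      ext i
      rw [hA.sym, hf, inner_smul_right, real_inner_comm (f i) (g j)]; ring
    rw [e]; exact this
  have hzero : ∀ i j, gam j = 0 → lam i * ⟪f i, g j⟫ ^ 2 = 0 := by
    intro i j hj
    have h2 : ⟪g j, mix φ α P Q (g j)⟫ = 0 := by rw [hg', hj]; simp
    rw [mix] at h2
    simp only [_root_.add_apply, _root_.smul_apply, inner_add_right, inner_smul_right] at h2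
    have h3 := hA.nonneg (g j)
    have h4 := (covOp_psd Q hφc hφ1).nonneg (g j)
    have h5 : 0 ≤ (1 - α) * ⟪g j, covOp φ Q (g j)⟫ := mul_nonneg (by linarith) h4
    have h6 : ⟪g j, covOp φ P (g j)⟫ = 0 := by
      have : α * ⟪g j, covOp φ P (g j)⟫ = 0 := by
        have := mul_nonneg h0.le h3
        linarith
      exact (mul_eq_zero.1 this).resolve_left h0.ne'
    have h7 := hcol j
    rw [h6, hasSum_zero_iff_of_nonneg] at h7
    · exact congrFun h7 i
    · intro i; exact mul_nonneg (hlam i) (sq_nonneg _)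
  set F : ι × ι → ℝ → ℝ := fun ij β =>
    lam ij.1 * ⟪f ij.1, g ij.2⟫ ^ 2 * ((gam ij.2 + β)⁻¹ - (lam ij.1 + β)⁻¹) with hF
  set t : ι × ι → ℝ := fun ij =>
    lam ij.1 * Real.log (lam ij.1 / gam ij.2) * ⟪f ij.1, g ij.2⟫ ^ 2 with ht
  have hpos : ∀ ij : ι × ι, lam ij.1 * ⟪f ij.1, g ij.2⟫ ^ 2 ≠ 0 →
      0 < lam ij.1 ∧ 0 < gam ij.2 := by
    intro ij hne
    constructor
    · exact lt_of_le_of_ne (hlam _) fun h => hne (by rw [← h]; simp)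
    · exact lt_of_le_of_ne (hgam _) fun h => hne (hzero _ _ h.symm)
  have hFint : ∀ ij, IntegrableOn (F ij) (Set.Ioi 0) ∧ ∫ β in Set.Ioi (0:ℝ), F ij β = t ij ∧
      ∫ β in Set.Ioi (0:ℝ), ‖F ij β‖ = |t ij| ∧ (t ij = 0 → F ij = 0) := by
    intro ij
    by_cases hne : lam ij.1 * ⟪f ij.1, g ij.2⟫ ^ 2 = 0
    · have e : F ij = 0 := by ext β; simp only [hF, hne, zero_mul, Pi.zero_apply]
      have e2 : t ij = 0 := by
        simp only [ht]; rw [mul_right_comm, hne, zero_mul]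
      rw [e, e2]
      refine ⟨integrableOn_zero, by simp, by simp, fun _ => rfl⟩
    · obtain ⟨hl, hgm⟩ := hpos ij hne
      obtain ⟨i1, i2, i3⟩ := log_integral hl hgm
      refine ⟨i1.const_mul _, ?_, ?_, ?_⟩
      · simp only [hF, ht]
        rw [integral_const_mul, i2]; ring
      · simp only [hF, ht, norm_mul]
        rw [integral_const_mul, i3, Real.norm_eq_abs, Real.norm_eq_abs, ← abs_mul, ← abs_mul]
        congr 1; ring
      · intro h
        simp only [ht] at h
        rw [mul_right_comm] at h
        have h2 := (mul_eq_zero.1 h).resolve_left hne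
        have h3 : lam ij.1 / gam ij.2 = 1 :=
          Real.eq_one_of_pos_of_log_eq_zero (div_pos hl hgm) h2
        have h4 : lam ij.1 = gam ij.2 := by rwa [div_eq_one_iff_eq hgm.ne'] at h3
        ext β
        simp [hF, h4]
  -- pointwise sums
  have hpt : ∀ β ∈ Set.Ioi (0:ℝ), HasSum (fun ij => F ij β)
      (tr φ P (rs (mix φ α P Q) β) - tr φ P (rs (covOp φ P) β)) := by
    intro β hβ
    have hβ : 0 < β := hβ
    have s1 : HasSum (fun ij : ι × ι => lam ij.1 * ⟪f ij.1, g ij.2⟫ ^ 2 * (gam ij.2 + β)⁻¹)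
        (tr φ P (rs (mix φ α P Q) β)) := by
      rw [← (Equiv.prodComm ι ι).hasSum_iff]
      refine hasSum_prod_nonneg (b := fun j => ⟪g j, covOp φ P (g j)⟫ * (gam j + β)⁻¹) ?_ ?_ ?_
      · intro x
        have := hlam x.2
        have := hgam x.1
        simp only [Function.comp, Equiv.prodComm_apply, Prod.fst_swap, Prod.snd_swap]
        positivity
      · intro j
        exact (hcol j).mul_right _
      · have := trace_hasSum P hφc hφ1 g (rs (mix φ α P Q) β)
        have e : (fun j => ⟪g j, covOp φ P (g j)⟫ * (gam j + β)⁻¹)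
            = fun j => ⟪g j, rs (mix φ α P Q) β (covOp φ P (g j))⟫ := by
          ext j
          rw [← rs_sym hM hβ, rs_eigen hM hβ (hgam j) (hg' j), inner_smul_left]
          simp [mul_comm]
        rw [e]; exact this
    have s2 : HasSum (fun ij : ι × ι => lam ij.1 * ⟪f ij.1, g ij.2⟫ ^ 2 * (lam ij.1 + β)⁻¹)
        (tr φ P (rs (covOp φ P) β)) := by
      refine hasSum_prod_nonneg (b := fun i => lam i * (lam i + β)⁻¹) ?_ ?_ ?_
      · intro x
        have := hlam x.1
        positivity
      · intro i
        have := basis_sq_hasSum g (f i)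
        rw [f.orthonormal.1 i] at this
        have h2 := (this.mul_left (lam i)).mul_right (lam i + β)⁻¹
        simp only [one_pow, mul_one] at h2
        have e : (fun j => lam i * ⟪f i, g j⟫ ^ 2 * (lam i + β)⁻¹)
            = fun j => lam i * ⟪g j, f i⟫ ^ 2 * (lam i + β)⁻¹ := by
          ext j; rw [real_inner_comm]
        change HasSum (fun j => lam i * ⟪f i, g j⟫ ^ 2 * (lam i + β)⁻¹) _
        rw [e]; exact h2
      · have := trace_hasSum P hφc hφ1 f (rs (covOp φ P) β)
        have e : (fun i => lam i * (lam i + β)⁻¹)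
            = fun j => ⟪f j, rs (covOp φ P) β (covOp φ P (f j))⟫ := by
          ext j
          rw [hf, map_smul, rs_eigen hA hβ (hlam j) (hf j), inner_smul_right, inner_smul_right,
            real_inner_self_eq_norm_sq, f.orthonormal.1 j]
          simp
        rw [e]; exact this
    have := s1.sub s2
    simp only [hF, mul_sub]
    exact this
  -- countable support
  set C := Function.support t with hC
  have hCc : Countable C := hsum.countable_support
  have hsupp : ∀ β, Function.support (fun ij => F ij β) ⊆ C := by
    intro β ij hij
    by_contra hn
    have : t ij = 0 := by simpa [hC] using hn
    apply hij
    simp only [(hFint ij).2.2.2 this, Pi.zero_apply]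
  have hpt' : ∀ β ∈ Set.Ioi (0:ℝ), HasSum (fun ij : C => F ij β)
      (tr φ P (rs (mix φ α P Q) β) - tr φ P (rs (covOp φ P) β)) := fun β hβ =>
    (hasSum_subtype_iff_of_support_subset (hsupp β)).2 (hpt β hβ)
  have hsn : Summable fun ij : C => ∫ β in Set.Ioi (0:ℝ), ‖F ij β‖ := by
    have : (fun ij : C => ∫ β in Set.Ioi (0:ℝ), ‖F ij β‖) = fun ij : C => |t ij| := by
      ext ij; exact (hFint ij).2.2.1
    rw [this]
    exact hsum.abs.subtype C
  have hmain := hasSum_integral_of_summable_integral_norm (fun ij : C => (hFint ij).1) hsn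
  constructor
  · refine ⟨?_, ?_⟩
    · refine ContinuousOn.aestronglyMeasurable ?_ measurableSet_Ioi
      exact ((tr_continuous P hφc hφ1).comp_continuousOn (rs_continuousOn' hM)).sub
        ((tr_continuous P hφc hφ1).comp_continuousOn (rs_continuousOn' hA))
    · rw [hasFiniteIntegral_def]
      calc ∫⁻ β in Set.Ioi (0:ℝ),
            ‖tr φ P (rs (mix φ α P Q) β) - tr φ P (rs (covOp φ P) β)‖ₑ
          ≤ ∫⁻ β in Set.Ioi (0:ℝ), ∑' ij : C, ‖F ij β‖ₑ := by
            refine setLIntegral_mono' measurableSet_Ioi fun β hβ => ?_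
            rw [← (hpt' β hβ).tsum_eq]
            exact enorm_tsum_le_tsum_enorm
        _ = ∑' ij : C, ∫⁻ β in Set.Ioi (0:ℝ), ‖F ij β‖ₑ :=
            lintegral_tsum fun ij => (hFint ij).1.aestronglyMeasurable.enorm
        _ = ∑' ij : C, ENNReal.ofReal (∫ β in Set.Ioi (0:ℝ), ‖F ij β‖) := by
            congr 1; ext ij
            rw [ofReal_integral_norm_eq_lintegral_enorm (hFint ij).1]
        _ = ENNReal.ofReal (∑' ij : C, ∫ β in Set.Ioi (0:ℝ), ‖F ij β‖) :=
            (ENNReal.ofReal_tsum_of_nonneg (fun ij => integral_nonneg fun _ => norm_nonneg _)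
              hsn).symm
        _ < ⊤ := ENNReal.ofReal_lt_top
  · have e1 : ∫ β in Set.Ioi (0:ℝ), ∑' ij : C, F ij β = ∫ β in Set.Ioi (0:ℝ),
        (tr φ P (rs (mix φ α P Q) β) - tr φ P (rs (covOp φ P) β)) :=
      setIntegral_congr_fun measurableSet_Ioi fun β hβ => (hpt' β hβ).tsum_eq
    rw [← e1, ← hmain.tsum_eq]
    have e2 : (fun ij : C => ∫ β in Set.Ioi (0:ℝ), F ij β) = fun ij : C => t ij := by
      ext ij; exact (hFint ij).2.1
    rw [e2, tsum_subtype_support]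

end KKL

section Variance

variable {d n : ℕ} {Ω : Type*} [MeasurableSpace Ω] {μ : Measure Ω} [IsProbabilityMeasure μ]
variable {P : Measure (EuclideanSpace ℝ (Fin d))} [IsProbabilityMeasure P]
variable {xs : Ω → Fin n → EuclideanSpace ℝ (Fin d)}
variable {E : Type*} [NormedAddCommGroup E] [InnerProductSpace ℝ E] [CompleteSpace E]

theorem mp_eval (h : MeasurePreserving xs μ (Measure.pi fun _ : Fin n => P)) (i : Fin n) :
    MeasurePreserving (fun ω => xs ω i) μ P :=
  (measurePreserving_eval (fun _ : Fin n => P) i).comp h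

theorem mp_pair (h : MeasurePreserving xs μ (Measure.pi fun _ : Fin n => P)) {i j : Fin n}
    (hij : i ≠ j) :
    MeasurePreserving (fun ω => (xs ω i, xs ω j)) μ (P.prod P) := by
  have h1 : MeasurePreserving (fun x : Fin n → EuclideanSpace ℝ (Fin d) => (x i, x j))
      (Measure.pi fun _ : Fin n => P) (P.prod P) := by
    refine ⟨by fun_prop, ?_⟩
    have hi := ProbabilityTheory.iIndepFun_pi (μ := fun _ : Fin n => P)
      (X := fun (_ : Fin n) (x : EuclideanSpace ℝ (Fin d)) => x) (fun i => aemeasurable_id)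
    have h2 := hi.indepFun hij
    rw [ProbabilityTheory.indepFun_iff_map_prod_eq_prod_map_map
      (measurable_pi_apply i).aemeasurable (measurable_pi_apply j).aemeasurable] at h2
    rw [h2]
    have e1 := (measurePreserving_eval (fun _ : Fin n => P) i).map_eq
    have e2 := (measurePreserving_eval (fun _ : Fin n => P) j).map_eq
    congr 1
  exact h1.comp h

theorem emp_variance (hn : 0 < n) (h : MeasurePreserving xs μ (Measure.pi fun _ : Fin n => P))
    {F : EuclideanSpace ℝ (Fin d) → E} (hF : Continuous F) {C : ℝ} (hC : ∀ x, ‖F x‖ ≤ C) :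
    ∫⁻ ω, ENNReal.ofReal (‖∫ x, F x ∂(empMeas (xs ω)) - ∫ x, F x ∂P‖ ^ 2) ∂μ
      ≤ ENNReal.ofReal ((n:ℝ)⁻¹ * ∫ x, ‖F x‖ ^ 2 ∂P) := by
  set ν : E := ∫ x, F x ∂P with hν
  set G : EuclideanSpace ℝ (Fin d) → E := fun x => F x - ν with hG
  have hGc : Continuous G := by fun_prop
  have hGC : ∀ x, ‖G x‖ ≤ C + ‖ν‖ := fun x => (norm_sub_le _ _).trans (by gcongr; exact hC x)
  have hC0 : 0 ≤ C := (norm_nonneg _).trans (hC 0)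
  have hFi : Integrable F P := bcint hF C hC
  have hGi : Integrable G P := bcint hGc _ hGC
  have hF2 : Integrable (fun x => ‖F x‖ ^ 2) P := bcint (by fun_prop) (C ^ 2) fun x => by
    rw [norm_pow, norm_norm]; gcongr; exact hC x
  have hG0 : ∫ x, G x ∂P = 0 := by
    simp only [hG]
    rw [integral_sub hFi (integrable_const _), ← hν]; simp
  have hGsq : ∫ x, ‖G x‖ ^ 2 ∂P ≤ ∫ x, ‖F x‖ ^ 2 ∂P := by
    have e : (fun x => ‖G x‖ ^ 2) = fun x => ‖F x‖ ^ 2 - 2 * ⟪ν, F x⟫ + ‖ν‖ ^ 2 := by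
      ext x; simp only [hG]; rw [norm_sub_sq_real, real_inner_comm]
    have hi : Integrable (fun x => 2 * ⟪ν, F x⟫) P := (hFi.const_inner ν).const_mul 2
    have hi2 : Integrable (fun x => ‖F x‖ ^ 2 - 2 * ⟪ν, F x⟫) P := hF2.sub hi
    rw [e, integral_add hi2 (integrable_const _), integral_sub hF2 hi,
      integral_const_mul, integral_inner hFi, ← hν, real_inner_self_eq_norm_sq]
    simp
    nlinarith [sq_nonneg ‖ν‖]
  have hn' : (n:ℝ) ≠ 0 := by positivity
  have hexp : ∀ ω, ‖∫ x, F x ∂(empMeas (xs ω)) - ν‖ ^ 2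
      = ((n:ℝ)⁻¹) ^ 2 * ∑ i, ∑ j, ⟪G (xs ω i), G (xs ω j)⟫ := by
    intro ω
    have : ∫ x, F x ∂(empMeas (xs ω)) - ν = (n:ℝ)⁻¹ • ∑ i, G (xs ω i) := by
      rw [empMeas_integral]
      simp only [hG, Finset.sum_sub_distrib, Finset.sum_const, Finset.card_univ, Fintype.card_fin,
        smul_sub]
      rw [← Nat.cast_smul_eq_nsmul ℝ, smul_smul, inv_mul_cancel₀ hn', one_smul]
    rw [this, norm_smul, mul_pow, ← real_inner_self_eq_norm_sq (∑ i, G (xs ω i)), sum_inner]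
    simp only [inner_sum]
    rw [Real.norm_eq_abs, sq_abs]
  have hprodI : Integrable (fun z : EuclideanSpace ℝ (Fin d) × EuclideanSpace ℝ (Fin d) =>
      ⟪G z.1, G z.2⟫) (P.prod P) := bcint (by fun_prop) ((C + ‖ν‖) * (C + ‖ν‖)) fun z => by
    refine (norm_inner_le_norm _ _).trans ?_
    gcongr
    · exact hGC _
    · exact hGC _
  have hdiagI : Integrable (fun x => ⟪G x, G x⟫) P :=
    bcint (by fun_prop) ((C + ‖ν‖) * (C + ‖ν‖)) fun z => by
      refine (norm_inner_le_norm _ _).trans ?_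
      gcongr
      · exact hGC _
      · exact hGC _
  have hterm : ∀ i j, Integrable (fun ω => ⟪G (xs ω i), G (xs ω j)⟫) μ ∧
      ∫ ω, ⟪G (xs ω i), G (xs ω j)⟫ ∂μ = if i = j then ∫ x, ‖G x‖ ^ 2 ∂P else 0 := by
    intro i j
    by_cases hij : i = j
    · subst hij
      have hm := mp_eval h i
      have hm' : AEStronglyMeasurable (fun x => ⟪G x, G x⟫) (Measure.map (fun ω => xs ω i) μ) := by
        rw [hm.map_eq]; exact hdiagI.1
      refine ⟨hm.integrable_comp_of_integrable hdiagI, ?_⟩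
      rw [if_pos rfl]
      have := integral_map hm.measurable.aemeasurable hm'
      rw [hm.map_eq] at this
      rw [← this]
      simp only [real_inner_self_eq_norm_sq]
    · have hm := mp_pair h hij
      have hm' : AEStronglyMeasurable (fun z : EuclideanSpace ℝ (Fin d) × EuclideanSpace ℝ (Fin d)
          => ⟪G z.1, G z.2⟫) (Measure.map (fun ω => (xs ω i, xs ω j)) μ) := by
        rw [hm.map_eq]; exact hprodI.1
      refine ⟨hm.integrable_comp_of_integrable hprodI, ?_⟩
      rw [if_neg hij]
      have := integral_map hm.measurable.aemeasurable hm'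
      rw [hm.map_eq] at this
      rw [← this, integral_prod _ hprodI]
      simp only [integral_inner hGi, hG0, inner_zero_right, integral_zero]
  have hInt : Integrable (fun ω => ‖∫ x, F x ∂(empMeas (xs ω)) - ν‖ ^ 2) μ := by
    simp only [hexp]
    exact (integrable_finsetSum _ fun i _ => integrable_finsetSum _ fun j _ =>
      (hterm i j).1).const_mul _
  rw [← ofReal_integral_eq_lintegral_ofReal hInt (ae_of_all _ fun ω => by positivity)]
  apply ENNReal.ofReal_le_ofReal
  simp only [hexp]
  rw [integral_const_mul, integral_finsetSum _ fun i _ => integrable_finsetSum _ fun j _ =>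
      (hterm i j).1]
  have : ∀ i, ∫ ω, ∑ j, ⟪G (xs ω i), G (xs ω j)⟫ ∂μ = ∫ x, ‖G x‖ ^ 2 ∂P := by
    intro i
    rw [integral_finsetSum _ fun j _ => (hterm i j).1]
    simp [(hterm _ _).2]
  simp only [this, Finset.sum_const, Finset.card_univ, Fintype.card_fin, nsmul_eq_mul]
  have e : ((n:ℝ)⁻¹) ^ 2 * (n * ∫ x, ‖G x‖ ^ 2 ∂P) = (n:ℝ)⁻¹ * ∫ x, ‖G x‖ ^ 2 ∂P := by
    field_simp
  rw [e]
  gcongr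

theorem l1_of_l2 {f : Ω → ℝ} {s : ℝ} (hs : 0 < s)
    (h : ∫⁻ ω, ENNReal.ofReal (f ω ^ 2) ∂μ ≤ ENNReal.ofReal (s ^ 2)) :
    ∫⁻ ω, ENNReal.ofReal |f ω| ∂μ ≤ ENNReal.ofReal s := by
  calc ∫⁻ ω, ENNReal.ofReal |f ω| ∂μ
      ≤ ∫⁻ ω, (ENNReal.ofReal (1 / (2 * s)) * ENNReal.ofReal (f ω ^ 2) + ENNReal.ofReal (s / 2)) ∂μ := by
        refine lintegral_mono fun ω => ?_
        rw [← ENNReal.ofReal_mul (by positivity), ← ENNReal.ofReal_add (by positivity) (by positivity)]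
        apply ENNReal.ofReal_le_ofReal
        have h2 : 0 ≤ (|f ω| - s) ^ 2 / (2 * s) := by positivity
        have e : (|f ω| - s) ^ 2 / (2 * s) = 1 / (2 * s) * f ω ^ 2 + s / 2 - |f ω| := by
          rw [← sq_abs (f ω)]; field_simp; ring
        linarith
    _ = ENNReal.ofReal (1 / (2 * s)) * ∫⁻ ω, ENNReal.ofReal (f ω ^ 2) ∂μ + ENNReal.ofReal (s / 2) := by
        rw [lintegral_add_right _ measurable_const, lintegral_const_mul' _ _ ENNReal.ofReal_ne_top]
        simp
    _ ≤ ENNReal.ofReal (1 / (2 * s)) * ENNReal.ofReal (s ^ 2) + ENNReal.ofReal (s / 2) := by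
        gcongr
    _ = ENNReal.ofReal s := by
        rw [← ENNReal.ofReal_mul (by positivity), ← ENNReal.ofReal_add (by positivity) (by positivity)]
        congr 1; field_simp; ring

/-- L1 deviation of an empirical mean. -/
theorem emp_l1 (hn : 0 < n) (h : MeasurePreserving xs μ (Measure.pi fun _ : Fin n => P))
    {F : EuclideanSpace ℝ (Fin d) → ℝ} (hF : Continuous F) {C : ℝ} (hC : ∀ x, ‖F x‖ ≤ C)
    {s : ℝ} (hs : 0 < s) (hs2 : ∫ x, F x ^ 2 ∂P ≤ s ^ 2) {k : ℝ} (hk : 0 < k) (hkn : k ≤ n) :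
    ∫⁻ ω, ENNReal.ofReal |∫ x, F x ∂(empMeas (xs ω)) - ∫ x, F x ∂P| ∂μ
      ≤ ENNReal.ofReal (s / √k) := by
  have hk' : 0 < √k := Real.sqrt_pos.2 hk
  refine l1_of_l2 (by positivity) ?_
  have := emp_variance hn h hF hC
  simp only [Real.norm_eq_abs, sq_abs] at this
  refine this.trans (ENNReal.ofReal_le_ofReal ?_)
  rw [div_pow, Real.sq_sqrt hk.le, div_eq_inv_mul]
  have : 0 ≤ ∫ x, F x ^ 2 ∂P := integral_nonneg fun x => sq_nonneg _
  gcongr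

end Variance

section Fixed

variable {d n m : ℕ} {Ω : Type*} [MeasurableSpace Ω] [TopologicalSpace Ω]
  [SecondCountableTopology Ω] [OpensMeasurableSpace Ω]

/-- A sampling model. -/
structure Smp (μ : Measure Ω) (P Q : Measure (EuclideanSpace ℝ (Fin d)))
    (xs : Ω → Fin n → EuclideanSpace ℝ (Fin d)) (ys : Ω → Fin m → EuclideanSpace ℝ (Fin d))
    (k : ℝ) : Prop where
  hn : 0 < n
  hm : 0 < m
  cx : Continuous xs
  cy : Continuous ys
  px : MeasurePreserving xs μ (Measure.pi fun _ : Fin n => P)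
  py : MeasurePreserving ys μ (Measure.pi fun _ : Fin m => Q)
  hk : 0 < k
  kn : k ≤ n
  km : k ≤ m

variable {μ : Measure Ω} [IsProbabilityMeasure μ]
variable {P Q : Measure (EuclideanSpace ℝ (Fin d))} [IsProbabilityMeasure P]
  [IsProbabilityMeasure Q]
variable {xs : Ω → Fin n → EuclideanSpace ℝ (Fin d)} {ys : Ω → Fin m → EuclideanSpace ℝ (Fin d)}
variable {k : ℝ}
variable {H : Type u} [NormedAddCommGroup H] [InnerProductSpace ℝ H] [CompleteSpace H]
variable {φ : EuclideanSpace ℝ (Fin d) → H}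

theorem emp_mean (hn : 0 < n) (h : MeasurePreserving xs μ (Measure.pi fun _ : Fin n => P))
    {F : EuclideanSpace ℝ (Fin d) → ℝ} (hF : Continuous F) {C : ℝ} (hC : ∀ x, ‖F x‖ ≤ C)
    (h0 : ∀ x, 0 ≤ F x) :
    ∫⁻ ω, ENNReal.ofReal (∫ x, F x ∂(empMeas (xs ω))) ∂μ = ENNReal.ofReal (∫ x, F x ∂P) := by
  have hFi : Integrable F P := bcint hF C hC
  have hterm : ∀ i, Integrable (fun ω => F (xs ω i)) μ ∧ ∫ ω, F (xs ω i) ∂μ = ∫ x, F x ∂P := by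
    intro i
    have hm := mp_eval h i
    have hm' : AEStronglyMeasurable F (Measure.map (fun ω => xs ω i) μ) := by
      rw [hm.map_eq]; exact hFi.1
    refine ⟨hm.integrable_comp_of_integrable hFi, ?_⟩
    have := integral_map hm.measurable.aemeasurable hm'
    rw [hm.map_eq] at this
    rw [← this]
  have hn' : (n:ℝ) ≠ 0 := by positivity
  simp only [empMeas_integral, smul_eq_mul]
  rw [← ofReal_integral_eq_lintegral_ofReal]
  · rw [integral_const_mul, integral_finsetSum _ fun i _ => (hterm i).1]
    simp only [(hterm _).2, Finset.sum_const, Finset.card_univ, Fintype.card_fin, nsmul_eq_mul]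
    rw [inv_mul_cancel_left₀ hn']
  · exact (integrable_finsetSum _ fun i _ => (hterm i).1).const_mul _
  · exact ae_of_all _ fun ω => mul_nonneg (by positivity) (Finset.sum_nonneg fun i _ => h0 _)

theorem emp_l1' (hn : 0 < n) (h : MeasurePreserving xs μ (Measure.pi fun _ : Fin n => P))
    {F : EuclideanSpace ℝ (Fin d) → ℝ} (hF : Continuous F) (c₀ : ℝ)
    {s : ℝ} (hs : 0 < s) (hs2 : ∀ x, |F x - c₀| ≤ s) (hk : 0 < k) (hkn : k ≤ n) :
    ∫⁻ ω, ENNReal.ofReal |∫ x, F x ∂(empMeas (xs ω)) - ∫ x, F x ∂P| ∂μ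
      ≤ ENNReal.ofReal (s / √k) := by
  have hi : ∀ S : Measure (EuclideanSpace ℝ (Fin d)), IsProbabilityMeasure S →
      ∫ x, (F x - c₀) ∂S = ∫ x, F x ∂S - c₀ := by
    intro S hS
    have h1 : Integrable F S := bcint hF (s + |c₀|) fun x => by
      have : F x = (F x - c₀) + c₀ := by ring
      rw [this]
      exact (norm_add_le _ _).trans (by gcongr; exact hs2 x; exact le_rfl)
    rw [integral_sub h1 (integrable_const _)]; simp
  have := emp_l1 (F := fun x => F x - c₀) hn h (by fun_prop) hs2 hs ?_ hk hkn
  · have e : ∀ ω, ∫ x, (F x - c₀) ∂(empMeas (xs ω)) - ∫ x, (F x - c₀) ∂P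
        = ∫ x, F x ∂(empMeas (xs ω)) - ∫ x, F x ∂P := by
      intro ω
      rw [hi _ (empMeas_prob hn _), hi P inferInstance]; ring
    simp only [e] at this
    exact this
  · refine integral_le_of_le P (by positivity) fun x => ?_
    rw [← sq_abs]
    gcongr
    exact hs2 x

theorem mix_inner (φ : EuclideanSpace ℝ (Fin d) → H) (α : ℝ) (u v : H) :
    ⟪u, mix φ α P Q v⟫ = α * ⟪u, covOp φ P v⟫ + (1 - α) * ⟪u, covOp φ Q v⟫ := by
  simp [mix, inner_add_right, inner_smul_right]

theorem mix_quad_le (hφc : Continuous φ) (hφ1 : ∀ x, ‖φ x‖ = 1) {α : ℝ} (h0 : 0 ≤ α)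
    (h1 : α ≤ 1) (v : H) : ⟪v, mix φ α P Q v⟫ ≤ ‖v‖ ^ 2 := by
  rw [mix_inner]
  have := covOp_quad_le P hφc hφ1 v
  have := covOp_quad_le Q hφc hφ1 v
  have : 0 ≤ 1 - α := by linarith
  nlinarith

theorem mix_ge (hφc : Continuous φ) (hφ1 : ∀ x, ‖φ x‖ = 1) {α : ℝ}
    (h1 : α ≤ 1) (v : H) : ⟪v, (α • covOp φ P) v⟫ ≤ ⟪v, mix φ α P Q v⟫ := by
  rw [mix_inner, _root_.smul_apply, inner_smul_right]
  have := (covOp_psd Q hφc hφ1).nonneg v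
  have : 0 ≤ 1 - α := by linarith
  nlinarith

theorem rs_mix_le (hφc : Continuous φ) (hφ1 : ∀ x, ‖φ x‖ = 1) {α β : ℝ} (h0 : 0 ≤ α)
    (h1 : α ≤ 1) (hβ : 0 < β) (v : H) :
    ⟪v, rs (mix φ α P Q) β v⟫ ≤ ⟪v, rs (α • covOp φ P) β v⟫ :=
  rs_anti ((covOp_psd P hφc hφ1).smul h0) (mix_psd P Q hφc hφ1 h0 h1)
    (mix_ge hφc hφ1 h1) hβ v

/-- Pointwise bound for `(I)`. -/
theorem tr_emp_bound {ι : Type*} (P' : Measure (EuclideanSpace ℝ (Fin d)))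
    [IsProbabilityMeasure P'] (hφc : Continuous φ) (hφ1 : ∀ x, ‖φ x‖ = 1)
    {α β : ℝ} (h0 : 0 < α) (hβ : 0 < β) (f : HilbertBasis ι ℝ H) {lam : ι → ℝ}
    (hf : ∀ i, covOp φ P (f i) = lam i • f i) (hlam : ∀ i, 0 ≤ lam i) :
    tr φ P' (rs (α • covOp φ P') β) ≤
      ∫ x, ⟪rs (α • covOp φ P) β (φ x), (α • covOp φ P) (rs (α • covOp φ P) β (φ x))⟫ ∂P
      + ∫ x, β * ‖rs (α • covOp φ P) β (φ x)‖ ^ 2 ∂P' := by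
  have hA := (covOp_psd P hφc hφ1).smul h0.le
  have hA' := (covOp_psd P' hφc hφ1).smul h0.le
  set R := rs (α • covOp φ P) β with hR
  set R' := rs (α • covOp φ P') β with hR'
  have e1 : ∫ x, ⟪R (φ x), (α • covOp φ P) (R (φ x))⟫ ∂P
      = ∫ x, ⟪φ x, (R ∘L (α • covOp φ P) ∘L R) (φ x)⟫ ∂P := by
    congr 1; ext x
    simp only [ContinuousLinearMap.comp_apply]
    rw [hR, rs_sym hA hβ]
  have e2 : ∫ x, β * ‖R (φ x)‖ ^ 2 ∂P' = ∫ x, ⟪φ x, (β • (R ∘L R)) (φ x)⟫ ∂P' := by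
    congr 1; ext x
    simp only [ContinuousLinearMap.comp_apply, _root_.smul_apply, inner_smul_right]
    rw [← real_inner_self_eq_norm_sq, hR, rs_sym hA hβ]
  have s0 := trace_hasSum P' hφc hφ1 f R'
  have s1 := trace_hasSum P hφc hφ1 f (R ∘L (α • covOp φ P) ∘L R)
  have s2 := trace_hasSum P' hφc hφ1 f (β • (R ∘L R))
  rw [e1, e2, tr]
  refine hasSum_le (fun j => ?_) s0 (s1.add s2)
  have hl := hlam j
  have hRf : R (f j) = (α * lam j + β)⁻¹ • f j :=
    rs_eigen hA hβ (by positivity) (by rw [_root_.smul_apply, hf, smul_smul])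
  have hff : ⟪f j, f j⟫ = 1 := by
    rw [real_inner_self_eq_norm_sq, f.orthonormal.1 j]; simp
  set t := (α * lam j + β)⁻¹ with ht
  set a := ⟪f j, covOp φ P' (f j)⟫ with ha
  have htp : t * (α * lam j + β) = 1 := inv_mul_cancel₀ (by positivity)
  have f1 : ⟪f j, (R ∘L (α • covOp φ P) ∘L R) (covOp φ P (f j))⟫ = α * lam j ^ 2 * t ^ 2 := by
    simp only [ContinuousLinearMap.comp_apply, _root_.smul_apply, hf, map_smul, hRf,
      inner_smul_right, hff]
    ring
  have f2 : ⟪f j, (β • (R ∘L R)) (covOp φ P' (f j))⟫ = β * t ^ 2 * a := by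
    simp only [ContinuousLinearMap.comp_apply, _root_.smul_apply, inner_smul_right]
    rw [← rs_sym hA hβ, ← rs_sym hA hβ, ← hR, hRf, map_smul, hRf, inner_smul_left, inner_smul_left]
    simp only [RCLike.conj_to_real]
    ring
  have f3 : α * ⟪f j, R' (covOp φ P' (f j))⟫ + β * ⟪f j, R' (f j)⟫ = 1 := by
    have h := rs_right hA' hβ (f j)
    rw [← hR'] at h
    have h2 := congrArg (fun w => ⟪f j, w⟫) h
    simp only [inner_add_right, inner_smul_right, hff, _root_.smul_apply] at h2
    rw [← h2, ← (covOp_psd P' hφc hφ1).sym, hR', ← rs_sym hA' hβ, real_inner_comm]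
  have f4 := rs_var hA' hβ (f j) (t • f j)
  rw [← hR'] at f4
  simp only [_root_.smul_apply, map_smul, inner_smul_left, inner_smul_right, hff,
    RCLike.conj_to_real, norm_smul, f.orthonormal.1 j, ← ha, mul_pow, Real.norm_eq_abs, sq_abs] at f4
  rw [f1, f2]
  have key : α * ⟪f j, R' (covOp φ P' (f j))⟫ ≤ α * (α * lam j ^ 2 * t ^ 2 + β * t ^ 2 * a) := by
    have h5 : (α * lam j * t) ^ 2 = (1 - β * t) ^ 2 := by
      congr 1; linear_combination htp
    have h6 := mul_le_mul_of_nonneg_left f4 hβ.le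
    nlinarith
  exact le_of_mul_le_mul_left key h0

theorem bound_I {ι : Type*} (hS : Smp μ P Q xs ys k)
    (hφc : Continuous φ) (hφ1 : ∀ x, ‖φ x‖ = 1)
    {α β σ : ℝ} (h0 : 0 < α) (h1 : α ≤ 1) (hβ : 0 < β) (f : HilbertBasis ι ℝ H) {lam : ι → ℝ}
    (hf : ∀ i, covOp φ P (f i) = lam i • f i) (hlam : ∀ i, 0 ≤ lam i) (hσ0 : 0 < σ)
    (hσ : ∀ x, ⟪φ x, rs (α • covOp φ P) β (φ x)⟫ ≤ σ) :
    ∫⁻ ω, ENNReal.ofReal |tr φ (empMeas (xs ω)) (rs (mix φ α (empMeas (xs ω)) (empMeas (ys ω))) β)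
      - tr φ P (rs (mix φ α P Q) β)| ∂μ ≤ ENNReal.ofReal (2 * σ) := by
  have hA := (covOp_psd P hφc hφ1).smul h0.le
  have hT0 : 0 ≤ tr φ P (rs (mix φ α P Q) β) :=
    integral_nonneg fun x => (rs_psd (mix_psd P Q hφc hφ1 h0.le h1) hβ).nonneg _
  have hT1 : tr φ P (rs (mix φ α P Q) β) ≤ σ :=
    integral_le_of_le P hσ0.le fun x => (rs_mix_le hφc hφ1 h0.le h1 hβ _).trans (hσ x)
  set R := rs (α • covOp φ P) β with hR
  set a := ∫ x, ⟪R (φ x), (α • covOp φ P) (R (φ x))⟫ ∂P with ha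
  have ha0 : 0 ≤ a := integral_nonneg fun x => hA.nonneg _
  have hbd : ∀ x, ‖R (φ x)‖ ≤ 1 / β := fun x => by
    have := rs_norm_le hA hβ (φ x)
    rwa [hφ1] at this
  have hc2 : ∀ x, ‖β * ‖R (φ x)‖ ^ 2‖ ≤ β * (1 / β) ^ 2 := fun x => by
    rw [Real.norm_of_nonneg (by positivity)]
    gcongr
    exact hbd x
  have hpt : ∀ ω, |tr φ (empMeas (xs ω)) (rs (mix φ α (empMeas (xs ω)) (empMeas (ys ω))) β)
      - tr φ P (rs (mix φ α P Q) β)| ≤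
      (a + σ) + ∫ x, β * ‖R (φ x)‖ ^ 2 ∂(empMeas (xs ω)) := by
    intro ω
    have := empMeas_prob hS.hn (xs ω)
    have := empMeas_prob hS.hm (ys ω)
    have hM' := mix_psd (empMeas (xs ω)) (empMeas (ys ω)) hφc hφ1 h0.le h1
    have g0 : 0 ≤ tr φ (empMeas (xs ω)) (rs (mix φ α (empMeas (xs ω)) (empMeas (ys ω))) β) :=
      integral_nonneg fun x => (rs_psd hM' hβ).nonneg _
    have g1 : tr φ (empMeas (xs ω)) (rs (mix φ α (empMeas (xs ω)) (empMeas (ys ω))) β)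
        ≤ tr φ (empMeas (xs ω)) (rs (α • covOp φ (empMeas (xs ω))) β) :=
      integral_mono (quad_integrable _ hφc hφ1 _) (quad_integrable _ hφc hφ1 _)
        fun x => rs_mix_le hφc hφ1 h0.le h1 hβ _
    have g2 := tr_emp_bound (empMeas (xs ω)) hφc hφ1 h0 hβ f hf hlam
    rw [← hR, ← ha] at g2
    have g3 : 0 ≤ ∫ x, β * ‖R (φ x)‖ ^ 2 ∂(empMeas (xs ω)) :=
      integral_nonneg fun x => by positivity
    rw [abs_le]
    constructor <;> linarith
  have hInt : Integrable (fun x => ⟪R (φ x), (α • covOp φ P) (R (φ x))⟫) P := by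
    refine bcint (by fun_prop) ((1 / β) * (‖α • covOp φ P‖ * (1 / β))) fun x => ?_
    refine (norm_inner_le_norm _ _).trans ?_
    gcongr
    · exact hbd x
    · exact (ContinuousLinearMap.le_opNorm _ _).trans (by gcongr; exact hbd x)
  calc _ ≤ ∫⁻ ω, (ENNReal.ofReal (a + σ) +
        ENNReal.ofReal (∫ x, β * ‖R (φ x)‖ ^ 2 ∂(empMeas (xs ω)))) ∂μ := by
        refine lintegral_mono fun ω => ?_
        rw [← ENNReal.ofReal_add (by positivity) (integral_nonneg fun x => by positivity)]
        exact ENNReal.ofReal_le_ofReal (hpt ω)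
    _ = ENNReal.ofReal (a + σ) + ENNReal.ofReal (∫ x, β * ‖R (φ x)‖ ^ 2 ∂P) := by
        rw [lintegral_add_left measurable_const,
          emp_mean hS.hn hS.px (by fun_prop) hc2 fun x => by positivity]
        simp
    _ ≤ ENNReal.ofReal (2 * σ) := by
        rw [← ENNReal.ofReal_add (by positivity) (integral_nonneg fun x => by positivity)]
        apply ENNReal.ofReal_le_ofReal
        have : a + ∫ x, β * ‖R (φ x)‖ ^ 2 ∂P ≤ σ := by
          rw [ha, ← integral_add hInt (bcint (by fun_prop) _ hc2)]
          refine integral_le_of_le P hσ0.le fun x => ?_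
          rw [hR, ← rs_quad hA hβ]
          exact hσ x
        linarith

end Fixed

section FixedTwo

variable {d n m : ℕ} {Ω : Type*} [MeasurableSpace Ω] [TopologicalSpace Ω]
  [SecondCountableTopology Ω] [OpensMeasurableSpace Ω]
variable {μ : Measure Ω} [IsProbabilityMeasure μ]
variable {P Q : Measure (EuclideanSpace ℝ (Fin d))} [IsProbabilityMeasure P]
  [IsProbabilityMeasure Q]
variable {xs : Ω → Fin n → EuclideanSpace ℝ (Fin d)} {ys : Ω → Fin m → EuclideanSpace ℝ (Fin d)}
variable {k : ℝ}
variable {H : Type u} [NormedAddCommGroup H] [InnerProductSpace ℝ H] [CompleteSpace H]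
variable {φ : EuclideanSpace ℝ (Fin d) → H}

theorem D_var (hn : 0 < n) (h : MeasurePreserving xs μ (Measure.pi fun _ : Fin n => P))
    (hk : 0 < k) (hkn : k ≤ n) (hφc : Continuous φ) (hφ1 : ∀ x, ‖φ x‖ = 1) (v : H) :
    ∫⁻ ω, ENNReal.ofReal (‖covOp φ (empMeas (xs ω)) v - covOp φ P v‖ ^ 2) ∂μ
      ≤ ENNReal.ofReal (k⁻¹ * ⟪v, covOp φ P v⟫) := by
  have h1 := emp_variance (F := fun x => ⟪φ x, v⟫ • φ x) hn h (by fun_prop) (C := ‖v‖) fun x => by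
    rw [norm_smul, hφ1, mul_one]; exact abs_inner_phi_le hφ1 x v
  have e : ∀ ω, ‖covOp φ (empMeas (xs ω)) v - covOp φ P v‖ ^ 2
      = ‖∫ x, ⟪φ x, v⟫ • φ x ∂(empMeas (xs ω)) - ∫ x, ⟪φ x, v⟫ • φ x ∂P‖ ^ 2 := by
    intro ω
    have := empMeas_prob hn (xs ω)
    rw [covOp_apply _ hφc hφ1, covOp_apply _ hφc hφ1]
  simp only [e]
  refine h1.trans (ENNReal.ofReal_le_ofReal ?_)
  rw [covOp_quad P hφc hφ1]
  simp only [norm_smul, hφ1, mul_one, Real.norm_eq_abs, sq_abs]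
  have : 0 ≤ ∫ x, ⟪φ x, v⟫ ^ 2 ∂P := integral_nonneg fun x => sq_nonneg _
  gcongr

theorem mix_emp_continuous (hS : Smp μ P Q xs ys k) (hφc : Continuous φ) (α : ℝ) :
    Continuous fun ω => mix φ α (empMeas (xs ω)) (empMeas (ys ω)) := by
  have h1 : Continuous fun ω => covOp φ (empMeas (xs ω)) :=
    (covOp_emp_continuous hφc).comp hS.cx
  have h2 : Continuous fun ω => covOp φ (empMeas (ys ω)) :=
    (covOp_emp_continuous hφc).comp hS.cy
  unfold mix
  fun_prop

theorem Delta_var (hS : Smp μ P Q xs ys k) (hφc : Continuous φ) (hφ1 : ∀ x, ‖φ x‖ = 1)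
    {α : ℝ} (h0 : 0 ≤ α) (h1 : α ≤ 1) (v : H) :
    ∫⁻ ω, ENNReal.ofReal
      (‖(mix φ α P Q - mix φ α (empMeas (xs ω)) (empMeas (ys ω))) v‖ ^ 2) ∂μ
      ≤ ENNReal.ofReal (k⁻¹ * ⟪v, mix φ α P Q v⟫) := by
  have hk := hS.hk
  have d1 := D_var hS.hn hS.px hS.hk hS.kn hφc hφ1 v
  have d2 := D_var hS.hm hS.py hS.hk hS.km hφc hφ1 v
  have h1' : 0 ≤ 1 - α := by linarith
  have hc : Continuous fun ω => covOp φ (empMeas (xs ω)) :=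
    (covOp_emp_continuous hφc).comp hS.cx
  have n1 := (covOp_psd P hφc hφ1).nonneg v
  have n2 := (covOp_psd Q hφc hφ1).nonneg v
  calc _ ≤ ∫⁻ ω, (ENNReal.ofReal α *
          ENNReal.ofReal (‖covOp φ (empMeas (xs ω)) v - covOp φ P v‖ ^ 2)
        + ENNReal.ofReal (1 - α) *
          ENNReal.ofReal (‖covOp φ (empMeas (ys ω)) v - covOp φ Q v‖ ^ 2)) ∂μ := by
        refine lintegral_mono fun ω => ?_
        rw [← ENNReal.ofReal_mul h0, ← ENNReal.ofReal_mul h1',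
          ← ENNReal.ofReal_add (by positivity) (by positivity)]
        apply ENNReal.ofReal_le_ofReal
        have e : (mix φ α P Q - mix φ α (empMeas (xs ω)) (empMeas (ys ω))) v
            = -(α • (covOp φ (empMeas (xs ω)) v - covOp φ P v)
              + (1 - α) • (covOp φ (empMeas (ys ω)) v - covOp φ Q v)) := by
          simp only [mix, _root_.sub_apply, _root_.add_apply, _root_.smul_apply]
          module
        rw [e, norm_neg]
        generalize covOp φ (empMeas (xs ω)) v - covOp φ P v = a
        generalize covOp φ (empMeas (ys ω)) v - covOp φ Q v = b
        have hn1 : ‖α • a + (1 - α) • b‖ ≤ α * ‖a‖ + (1 - α) * ‖b‖ := by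
          refine (norm_add_le _ _).trans ?_
          rw [norm_smul, norm_smul, Real.norm_of_nonneg h0, Real.norm_of_nonneg h1']
        have hn2 : ‖α • a + (1 - α) • b‖ ^ 2 ≤ (α * ‖a‖ + (1 - α) * ‖b‖) ^ 2 := by gcongr
        have hn3 : 0 ≤ α * (1 - α) * (‖a‖ - ‖b‖) ^ 2 := by positivity
        nlinarith
    _ = ENNReal.ofReal α *
          ∫⁻ ω, ENNReal.ofReal (‖covOp φ (empMeas (xs ω)) v - covOp φ P v‖ ^ 2) ∂μ
        + ENNReal.ofReal (1 - α) *
          ∫⁻ ω, ENNReal.ofReal (‖covOp φ (empMeas (ys ω)) v - covOp φ Q v‖ ^ 2) ∂μ := by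
        rw [lintegral_add_left, lintegral_const_mul' _ _ ENNReal.ofReal_ne_top,
          lintegral_const_mul' _ _ ENNReal.ofReal_ne_top]
        have : Continuous fun ω => ‖covOp φ (empMeas (xs ω)) v - covOp φ P v‖ ^ 2 := by fun_prop
        exact (this.measurable.ennreal_ofReal).const_mul _
    _ ≤ ENNReal.ofReal α * ENNReal.ofReal (k⁻¹ * ⟪v, covOp φ P v⟫)
        + ENNReal.ofReal (1 - α) * ENNReal.ofReal (k⁻¹ * ⟪v, covOp φ Q v⟫) := by gcongr
    _ = _ := by
        rw [← ENNReal.ofReal_mul h0, ← ENNReal.ofReal_mul h1',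
          ← ENNReal.ofReal_add (by positivity) (by positivity), mix_inner]
        congr 1; ring

theorem cov_swap (S : Measure (EuclideanSpace ℝ (Fin d))) [IsProbabilityMeasure S]
    (hφc : Continuous φ) (hφ1 : ∀ x, ‖φ x‖ = 1)
    {R : H →L[ℝ] H} (hR : Psd R) :
    ∫ x, ⟪R (φ x), covOp φ S (R (φ x))⟫ ∂P = ∫ z, ⟪R (φ z), covOp φ P (R (φ z))⟫ ∂S := by
  simp only [covOp_quad S hφc hφ1, covOp_quad P hφc hφ1]
  rw [integral_integral_swap]
  · congr 1; ext z; congr 1; ext x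
    rw [← hR.sym, real_inner_comm]
  · refine bcint (by fun_prop) (‖R‖ ^ 2) fun z => ?_
    simp only [Function.uncurry, norm_pow]
    gcongr
    refine (abs_inner_phi_le hφ1 _ _).trans ?_
    exact (R.le_opNorm _).trans (by rw [hφ1, mul_one])

/-- expansion of the population part -/
theorem quad_expand {M M' : H →L[ℝ] H} (h : Psd M) (h' : Psd M') {β : ℝ} (hβ : 0 < β) (v : H) :
    ⟪v, rs M' β v⟫ - ⟪v, rs M β v⟫ = ⟪rs M β v, (M - M') (rs M β v)⟫
      + ⟪(M - M') (rs M β v), rs M' β ((M - M') (rs M β v))⟫ := by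
  have hsym : ∀ u w, ⟪(M - M') u, w⟫ = ⟪u, (M - M') w⟫ := fun u w => by
    simp [inner_sub_left, inner_sub_right, h.sym, h'.sym]
  have e1 := rs_diff h h' hβ v
  have e2 := rs_diff' h h' hβ v
  conv_lhs => enter [1]; rw [e1]
  rw [inner_add_right, add_sub_cancel_left, ← rs_sym h hβ, e2, map_add, inner_add_right]
  rw [← hsym (rs M β v) (rs M' β _)]

/-- assumptions on the scale `s` -/
theorem t1_bound (hS : Smp μ P Q xs ys k) (hφc : Continuous φ) (hφ1 : ∀ x, ‖φ x‖ = 1)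
    {α β σ s : ℝ} (h0 : 0 < α) (h1 : α ≤ 1) (hβ : 0 < β) (hσ0 : 0 < σ)
    (hσ : ∀ x, ⟪φ x, rs (α • covOp φ P) β (φ x)⟫ ≤ σ) (hs : s = σ ∨ s = 1 / β ^ 2) :
    ∫⁻ ω, ENNReal.ofReal |tr φ (empMeas (xs ω)) (rs (mix φ α P Q) β)
      - tr φ P (rs (mix φ α P Q) β)| ∂μ ≤ ENNReal.ofReal (s / √k) := by
  have hM := mix_psd P Q hφc hφ1 h0.le h1
  unfold tr
  rcases hs with rfl | rfl
  · refine emp_l1' hS.hn hS.px (by fun_prop) 0 hσ0 (fun x => ?_) hS.hk hS.kn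
    rw [sub_zero, abs_of_nonneg ((rs_psd hM hβ).nonneg _)]
    exact (rs_mix_le hφc hφ1 h0.le h1 hβ _).trans (hσ x)
  · refine emp_l1' hS.hn hS.px (by fun_prop) (1 / β) (by positivity) (fun x => ?_) hS.hk hS.kn
    have a1 := rs_quad_le hM hβ (φ x)
    have a2 := rs_var hM hβ (φ x) (β⁻¹ • φ x)
    have a3 := mix_quad_le (P := P) (Q := Q) hφc hφ1 h0.le h1 (φ x)
    simp only [map_smul, inner_smul_left, inner_smul_right, RCLike.conj_to_real, norm_smul,
      Real.norm_eq_abs, real_inner_self_eq_norm_sq, hφ1, one_pow, mul_one, sq_abs] at a1 a2 a3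
    have a4 : β⁻¹ * (β⁻¹ * ⟪φ x, mix φ α P Q (φ x)⟫) ≤ 1 / β ^ 2 := by
      calc _ ≤ β⁻¹ * (β⁻¹ * 1) := by gcongr
        _ = _ := by field_simp
    have a5 : β * β⁻¹ ^ 2 = 1 / β := by field_simp
    have a6 : β⁻¹ = 1 / β := by simp
    have a7 : 0 < 1 / β ^ 2 := by positivity
    rw [abs_le]
    constructor
    · linarith
    · linarith

theorem t2_bound (hS : Smp μ P Q xs ys k) (hφc : Continuous φ) (hφ1 : ∀ x, ‖φ x‖ = 1)
    {α β σ s : ℝ} (h0 : 0 < α) (h1 : α ≤ 1) (hβ : 0 < β) (hσ0 : 0 < σ)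
    (hσ : ∀ x, ⟪φ x, rs (α • covOp φ P) β (φ x)⟫ ≤ σ) (hs : s = σ ∨ s = 1 / β ^ 2) :
    ∫⁻ ω, ENNReal.ofReal |∫ x, ⟪rs (mix φ α P Q) β (φ x),
      (mix φ α P Q - mix φ α (empMeas (xs ω)) (empMeas (ys ω))) (rs (mix φ α P Q) β (φ x))⟫ ∂P| ∂μ
        ≤ ENNReal.ofReal (2 * (s / √(α * k))) := by
  have hM := mix_psd P Q hφc hφ1 h0.le h1
  have hk := hS.hk
  have hs0 : 0 < s := by rcases hs with rfl | rfl <;> positivity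
  have h1' : 0 ≤ 1 - α := by linarith
  set R := rs (mix φ α P Q) β with hR
  have hRp : Psd R := rs_psd hM hβ
  set h2 : EuclideanSpace ℝ (Fin d) → ℝ := fun z => ⟪R (φ z), covOp φ P (R (φ z))⟫ with hh2
  have h2c : Continuous h2 := by fun_prop
  have hRn : ∀ z, ‖R (φ z)‖ ≤ 1 / β := fun z => by
    have := rs_norm_le hM hβ (φ z)
    rwa [hφ1] at this
  have h20 : ∀ z, 0 ≤ h2 z := fun z => (covOp_psd P hφc hφ1).nonneg _
  have h2b : ∀ z, h2 z ≤ 1 / β ^ 2 := fun z => by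
    refine (covOp_quad_le P hφc hφ1 _).trans ?_
    rw [← one_div_pow]
    have := hRn z
    gcongr
  have hh : ∀ z, ⟪φ z, R (φ z)⟫ ≤ σ := fun z => (rs_mix_le hφc hφ1 h0.le h1 hβ _).trans (hσ z)
  have hMq : ∀ z, α * h2 z + (1 - α) * ⟪R (φ z), covOp φ Q (R (φ z))⟫ ≤ σ := fun z => by
    rw [hh2, ← mix_inner]
    exact (rs_quad_le' hM hβ _).trans (hh z)
  have h2s : ∀ z, α * h2 z ≤ σ := fun z => by
    have := mul_nonneg h1' ((covOp_psd Q hφc hφ1).nonneg (R (φ z)))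
    linarith [hMq z]
  have h2q : ∀ z, (1 - α) * ⟪R (φ z), covOp φ Q (R (φ z))⟫ ≤ σ := fun z => by
    have := mul_nonneg h0.le (h20 z)
    linarith [hMq z]
  have hnorm : ∀ (S : Measure (EuclideanSpace ℝ (Fin d))) [IsProbabilityMeasure S],
      Integrable (fun x => ⟪R (φ x), covOp φ S (R (φ x))⟫) P := fun S _ => by
    refine bcint (by fun_prop) ((1 / β) * (‖covOp φ S‖ * (1 / β))) fun x => ?_
    refine (norm_inner_le_norm _ _).trans ?_
    gcongr
    · exact hRn x
    · exact (ContinuousLinearMap.le_opNorm _ _).trans (by gcongr; exact hRn x)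
  -- decomposition
  have hdec : ∀ ω, ∫ x, ⟪R (φ x),
      (mix φ α P Q - mix φ α (empMeas (xs ω)) (empMeas (ys ω))) (R (φ x))⟫ ∂P
      = -(∫ z, α * h2 z ∂(empMeas (xs ω)) - ∫ z, α * h2 z ∂P)
        - (∫ z, (1 - α) * h2 z ∂(empMeas (ys ω)) - ∫ z, (1 - α) * h2 z ∂Q) := by
    intro ω
    have := empMeas_prob hS.hn (xs ω)
    have := empMeas_prob hS.hm (ys ω)
    simp only [_root_.sub_apply, inner_sub_right, mix_inner]
    have i1 := (hnorm P).const_mul α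
    have i2 := (hnorm Q).const_mul (1 - α)
    have i3 := (hnorm (empMeas (xs ω))).const_mul α
    have i4 := (hnorm (empMeas (ys ω))).const_mul (1 - α)
    have i5 : Integrable (fun x => α * ⟪R (φ x), covOp φ P (R (φ x))⟫
      + (1 - α) * ⟪R (φ x), covOp φ Q (R (φ x))⟫) P := i1.add i2
    have i6 : Integrable (fun x => α * ⟪R (φ x), covOp φ (empMeas (xs ω)) (R (φ x))⟫
      + (1 - α) * ⟪R (φ x), covOp φ (empMeas (ys ω)) (R (φ x))⟫) P := i3.add i4
    rw [integral_sub i5 i6, integral_add i1 i2, integral_add i3 i4]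
    simp only [integral_const_mul]
    rw [cov_swap Q hφc hφ1 hRp, cov_swap (empMeas (xs ω)) hφc hφ1 hRp,
      cov_swap (empMeas (ys ω)) hφc hφ1 hRp]
    ring
  have hsqrt : √(α * k) = √α * √k := Real.sqrt_mul h0.le k
  have hsα : 0 < √α := Real.sqrt_pos.2 h0
  have hsα1 : √α ≤ 1 := Real.sqrt_le_one.2 h1
  have hsk : 0 < √k := Real.sqrt_pos.2 hk
  have b1 : ∫⁻ ω, ENNReal.ofReal |∫ z, α * h2 z ∂(empMeas (xs ω)) - ∫ z, α * h2 z ∂P| ∂μ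
      ≤ ENNReal.ofReal (s / √(α * k)) := by
    refine (emp_l1' hS.hn hS.px (by fun_prop) 0 hs0 (fun x => ?_) hS.hk hS.kn).trans
      (ENNReal.ofReal_le_ofReal ?_)
    · rw [sub_zero, abs_of_nonneg (mul_nonneg h0.le (h20 x))]
      rcases hs with rfl | rfl
      · exact h2s x
      · exact (mul_le_of_le_one_left (h20 x) h1).trans (h2b x)
    · rw [hsqrt]
      gcongr
      exact mul_le_of_le_one_left hsk.le hsα1
  have b2 : ∫⁻ ω, ENNReal.ofReal |∫ z, (1 - α) * h2 z ∂(empMeas (ys ω))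
      - ∫ z, (1 - α) * h2 z ∂Q| ∂μ ≤ ENNReal.ofReal (s / √(α * k)) := by
    have hF1 : ∀ z, (1 - α) * h2 z ≤ 1 / β ^ 2 := fun z =>
      (mul_le_of_le_one_left (h20 z) (by linarith)).trans (h2b z)
    have hF0 : ∀ z, 0 ≤ (1 - α) * h2 z := fun z => mul_nonneg h1' (h20 z)
    have e : s / √(α * k) = (s / √α) / √k := by rw [hsqrt]; field_simp
    rw [e]
    refine emp_l1 hS.hm hS.py (by fun_prop) (C := 1 / β ^ 2) (fun z => ?_) (by positivity) ?_
      hS.hk hS.km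
    · rw [Real.norm_of_nonneg (hF0 z)]; exact hF1 z
    · rw [div_pow, Real.sq_sqrt h0.le]
      rcases hs with rfl | rfl
      · have hI : ∫ z, (1 - α) * h2 z ∂Q ≤ s := by
          rw [integral_const_mul]
          simp only [hh2]
          rw [← cov_swap Q hφc hφ1 hRp, ← integral_const_mul]
          exact integral_le_of_le P hσ0.le h2q
        calc ∫ z, ((1 - α) * h2 z) ^ 2 ∂Q ≤ ∫ z, (s / α) * ((1 - α) * h2 z) ∂Q := by
              refine integral_mono ?_ ?_ fun z => ?_
              · refine bcint (by fun_prop) ((1 / β ^ 2) ^ 2) fun z => ?_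
                rw [norm_pow, Real.norm_of_nonneg (hF0 z)]
                have := hF1 z
                have := hF0 z
                gcongr
              · refine bcint (by fun_prop) ((s / α) * (1 / β ^ 2)) fun z => ?_
                have := hF1 z
                have := hF0 z
                rw [Real.norm_of_nonneg (by positivity)]
                gcongr
              · have t1 : (1 - α) * h2 z ≤ s / α := by
                  rw [le_div_iff₀ h0]
                  have := h2s z
                  have := h20 z
                  nlinarith [mul_nonneg h0.le (mul_nonneg h0.le this)]
                simp only [pow_two]
                exact mul_le_mul_of_nonneg_right t1 (hF0 z)
          _ ≤ (s / α) * s := by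
              rw [integral_const_mul]; gcongr
          _ = s ^ 2 / α := by ring
      · refine integral_le_of_le Q (by positivity) fun z => ?_
        have := hF1 z
        have := hF0 z
        calc ((1 - α) * h2 z) ^ 2 ≤ (1 / β ^ 2) ^ 2 := by gcongr
          _ ≤ (1 / β ^ 2) ^ 2 / α := by
            rw [le_div_iff₀ h0]
            exact mul_le_of_le_one_right (by positivity) h1
  have hc : Continuous fun ω => ∫ z, α * h2 z ∂(empMeas (xs ω)) := by
    simp only [empMeas_integral]
    have := hS.cx
    fun_prop
  calc _ ≤ ∫⁻ ω, (ENNReal.ofReal |∫ z, α * h2 z ∂(empMeas (xs ω)) - ∫ z, α * h2 z ∂P|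
        + ENNReal.ofReal |∫ z, (1 - α) * h2 z ∂(empMeas (ys ω)) - ∫ z, (1 - α) * h2 z ∂Q|) ∂μ := by
        refine lintegral_mono fun ω => ?_
        rw [← ENNReal.ofReal_add (abs_nonneg _) (abs_nonneg _)]
        apply ENNReal.ofReal_le_ofReal
        rw [hdec ω]
        refine (abs_sub _ _).trans ?_
        rw [abs_neg]
    _ ≤ ENNReal.ofReal (s / √(α * k)) + ENNReal.ofReal (s / √(α * k)) := by
        rw [lintegral_add_left]
        · gcongr
        · exact ((hc.sub continuous_const).abs.measurable).ennreal_ofReal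
    _ = _ := by
        rw [← ENNReal.ofReal_add (by positivity) (by positivity)]
        congr 1; ring

end FixedTwo

section FixedThree

variable {d n m : ℕ} {Ω : Type*} [MeasurableSpace Ω] [TopologicalSpace Ω]
  [SecondCountableTopology Ω] [OpensMeasurableSpace Ω]
variable {μ : Measure Ω} [IsProbabilityMeasure μ]
variable {P Q : Measure (EuclideanSpace ℝ (Fin d))} [IsProbabilityMeasure P]
  [IsProbabilityMeasure Q]
variable {xs : Ω → Fin n → EuclideanSpace ℝ (Fin d)} {ys : Ω → Fin m → EuclideanSpace ℝ (Fin d)}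
variable {k : ℝ}
variable {H : Type u} [NormedAddCommGroup H] [InnerProductSpace ℝ H] [CompleteSpace H]
variable {φ : EuclideanSpace ℝ (Fin d) → H}

theorem t4_bound (hS : Smp μ P Q xs ys k) (hφc : Continuous φ) (hφ1 : ∀ x, ‖φ x‖ = 1)
    {α β σ : ℝ} (h0 : 0 < α) (h1 : α ≤ 1) (hβ : 0 < β) (hσ0 : 0 < σ)
    (hσ : ∀ x, ⟪φ x, rs (α • covOp φ P) β (φ x)⟫ ≤ σ) :
    ∫⁻ ω, ENNReal.ofReal |∫ x, ⟪(mix φ α P Q - mix φ α (empMeas (xs ω)) (empMeas (ys ω)))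
        (rs (mix φ α P Q) β (φ x)), rs (mix φ α (empMeas (xs ω)) (empMeas (ys ω))) β
        ((mix φ α P Q - mix φ α (empMeas (xs ω)) (empMeas (ys ω)))
          (rs (mix φ α P Q) β (φ x)))⟫ ∂P| ∂μ ≤ ENNReal.ofReal (σ / (k * β)) := by
  have hM := mix_psd P Q hφc hφ1 h0.le h1
  have hk := hS.hk
  set R := rs (mix φ α P Q) β with hR
  have hcont := mix_emp_continuous hS hφc α
  set Dl : Ω → H →L[ℝ] H := fun ω => mix φ α P Q - mix φ α (empMeas (xs ω)) (empMeas (ys ω))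
    with hDl
  have hDc : Continuous Dl := by fun_prop
  have hjc : Continuous fun z : Ω × EuclideanSpace ℝ (Fin d) => ‖Dl z.1 (R (φ z.2))‖ ^ 2 := by
    fun_prop
  calc _ ≤ ∫⁻ ω, ENNReal.ofReal (1 / β) *
          ∫⁻ x, ENNReal.ofReal (‖Dl ω (R (φ x))‖ ^ 2) ∂P ∂μ := by
        refine lintegral_mono fun ω => ?_
        have := empMeas_prob hS.hn (xs ω)
        have := empMeas_prob hS.hm (ys ω)
        have hM' := mix_psd (empMeas (xs ω)) (empMeas (ys ω)) hφc hφ1 h0.le h1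
        have hq : ∀ x, ⟪Dl ω (R (φ x)), rs (mix φ α (empMeas (xs ω)) (empMeas (ys ω))) β
            (Dl ω (R (φ x)))⟫ ≤ (1 / β) * ‖Dl ω (R (φ x))‖ ^ 2 := fun x => by
          have := rs_quad_le hM' hβ (Dl ω (R (φ x)))
          rwa [div_eq_inv_mul, ← one_div] at this
        have hI : Integrable (fun x => (1 / β) * ‖Dl ω (R (φ x))‖ ^ 2) P := by
          refine bcint (by fun_prop) ((1 / β) * (‖Dl ω‖ * ‖R‖) ^ 2) fun x => ?_
          rw [Real.norm_of_nonneg (by positivity)]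
          gcongr
          refine (ContinuousLinearMap.le_opNorm _ _).trans ?_
          gcongr
          exact (ContinuousLinearMap.le_opNorm _ _).trans (by rw [hφ1, mul_one])
        rw [← lintegral_const_mul' _ _ ENNReal.ofReal_ne_top]
        simp only [← ENNReal.ofReal_mul (one_div_pos.2 hβ).le]
        rw [← ofReal_integral_eq_lintegral_ofReal hI (ae_of_all _ fun x => by positivity)]
        apply ENNReal.ofReal_le_ofReal
        rw [abs_of_nonneg (integral_nonneg fun x => (rs_psd hM' hβ).nonneg _)]
        exact integral_mono_of_nonneg (ae_of_all _ fun x => (rs_psd hM' hβ).nonneg _) hI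
          (ae_of_all _ hq)
    _ = ENNReal.ofReal (1 / β) * ∫⁻ x, ∫⁻ ω, ENNReal.ofReal (‖Dl ω (R (φ x))‖ ^ 2) ∂μ ∂P := by
        rw [lintegral_const_mul' _ _ ENNReal.ofReal_ne_top, lintegral_lintegral_swap]
        exact hjc.measurable.ennreal_ofReal.aemeasurable
    _ ≤ ENNReal.ofReal (1 / β) * ∫⁻ _, ENNReal.ofReal (k⁻¹ * σ) ∂P := by
        gcongr with x
        refine (Delta_var hS hφc hφ1 h0.le h1 (R (φ x))).trans (ENNReal.ofReal_le_ofReal ?_)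
        gcongr
        exact (rs_quad_le' hM hβ _).trans ((rs_mix_le hφc hφ1 h0.le h1 hβ _).trans (hσ x))
    _ = _ := by
        rw [lintegral_const, measure_univ, mul_one, ← ENNReal.ofReal_mul (by positivity)]
        congr 1; field_simp

theorem Y_bound {ι : Type*} (hS : Smp μ P Q xs ys k) (hφc : Continuous φ)
    (hφ1 : ∀ x, ‖φ x‖ = 1)
    {α β σ : ℝ} (h0 : 0 < α) (h1 : α ≤ 1) (hβ : 0 < β) (g : HilbertBasis ι ℝ H) {gam : ι → ℝ}
    (hg : ∀ j, mix φ α P Q (g j) = gam j • g j) (hgam : ∀ j, 0 ≤ gam j) (hσ0 : 0 < σ)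
    (hσ : ∀ x, ⟪φ x, rs (α • covOp φ P) β (φ x)⟫ ≤ σ) :
    ∫⁻ ω, ENNReal.ofReal |(tr φ (empMeas (xs ω)) (rs (mix φ α (empMeas (xs ω)) (empMeas (ys ω))) β)
        - tr φ (empMeas (xs ω)) (rs (mix φ α P Q) β))
      - (tr φ P (rs (mix φ α (empMeas (xs ω)) (empMeas (ys ω))) β)
        - tr φ P (rs (mix φ α P Q) β))| ∂μ ≤ ENNReal.ofReal (σ / (k * β)) := by
  have hM := mix_psd P Q hφc hφ1 h0.le h1
  have hA := covOp_psd P hφc hφ1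
  have hk := hS.hk
  set R := rs (mix φ α P Q) β with hR
  set r : ι → ℝ := fun j => (gam j + β)⁻¹ with hr
  have hr0 : ∀ j, 0 ≤ r j := fun j => by have := hgam j; simp only [hr]; positivity
  have hRg : ∀ j, R (g j) = r j • g j := fun j => rs_eigen hM hβ (hgam j) (hg j)
  have hcont := mix_emp_continuous hS hφc α
  have hcx : Continuous fun ω => covOp φ (empMeas (xs ω)) :=
    (covOp_emp_continuous hφc).comp hS.cx
  set M' : Ω → H →L[ℝ] H := fun ω => mix φ α (empMeas (xs ω)) (empMeas (ys ω)) with hM'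
  set D : Ω → H →L[ℝ] H := fun ω => covOp φ (empMeas (xs ω)) - covOp φ P with hD
  set Dl : Ω → H →L[ℝ] H := fun ω => mix φ α P Q - M' ω with hDl
  have hDc : Continuous D := by fun_prop
  have hDlc : Continuous Dl := by fun_prop
  obtain ⟨J, hJ, hJ0⟩ := exists_countable_supp hφc g
  have hJc : Countable J := hJ
  have hP'z : ∀ (S : Measure (EuclideanSpace ℝ (Fin d))) [IsProbabilityMeasure S], ∀ j ∉ J,
      covOp φ S (g j) = 0 := fun S _ j hj => by
    rw [covOp_apply S hφc hφ1]; simp [hJ0 j hj]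
  set a : ι → Ω → ℝ := fun j ω =>
    r j * (1 / (2 * β)) * (‖Dl ω (g j)‖ ^ 2 + ‖D ω (g j)‖ ^ 2) with ha
  have ha0 : ∀ j ω, 0 ≤ a j ω := fun j ω => by
    have := hr0 j
    simp only [ha]; positivity
  have hac : ∀ j, Continuous (a j) := fun j => by simp only [ha]; fun_prop
  have hpt : ∀ ω, ENNReal.ofReal |(tr φ (empMeas (xs ω)) (rs (M' ω) β)
        - tr φ (empMeas (xs ω)) R) - (tr φ P (rs (M' ω) β) - tr φ P R)|
      ≤ ∑' j : J, ENNReal.ofReal (a j ω) := by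
    intro ω
    have := empMeas_prob hS.hn (xs ω)
    have := empMeas_prob hS.hm (ys ω)
    have hMp : Psd (M' ω) := mix_psd (empMeas (xs ω)) (empMeas (ys ω)) hφc hφ1 h0.le h1
    have s1 := trace_hasSum (empMeas (xs ω)) hφc hφ1 g (rs (M' ω) β - R)
    have s2 := trace_hasSum P hφc hφ1 g (rs (M' ω) β - R)
    have s3 := s1.sub s2
    change HasSum _ (tr φ (empMeas (xs ω)) (rs (M' ω) β - R) - tr φ P (rs (M' ω) β - R)) at s3
    rw [tr_sub _ hφc hφ1, tr_sub _ hφc hφ1] at s3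
    have e : ∀ j, ⟪g j, (rs (M' ω) β - R) (covOp φ (empMeas (xs ω)) (g j))⟫
        - ⟪g j, (rs (M' ω) β - R) (covOp φ P (g j))⟫ = r j * ⟪Dl ω (g j), rs (M' ω) β (D ω (g j))⟫ := by
      intro j
      have hsym : ∀ u w, ⟪Dl ω u, w⟫ = ⟪u, Dl ω w⟫ := fun u w => by
        simp [hDl, inner_sub_left, inner_sub_right, hM.sym, hMp.sym]
      rw [← inner_sub_right, ← map_sub]
      have : covOp φ (empMeas (xs ω)) (g j) - covOp φ P (g j) = D ω (g j) := by simp [hD]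
      have hd : rs (M' ω) β (D ω (g j)) - R (D ω (g j)) = R (Dl ω (rs (M' ω) β (D ω (g j)))) :=
        sub_eq_iff_eq_add'.2 (rs_diff hM hMp hβ (D ω (g j)))
      rw [this, _root_.sub_apply, hd, hR, ← rs_sym hM hβ, ← hR, hRg, inner_smul_left, hsym]
      simp
    have hsupp : Function.support (fun j => ⟪g j, (rs (M' ω) β - R) (covOp φ (empMeas (xs ω)) (g j))⟫
        - ⟪g j, (rs (M' ω) β - R) (covOp φ P (g j))⟫) ⊆ J := by
      intro j hj
      by_contra hn
      apply hj
      simp [hP'z _ j hn]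
    rw [← hasSum_subtype_iff_of_support_subset hsupp] at s3
    rw [← s3.tsum_eq, ← Real.norm_eq_abs, ofReal_norm]
    refine enorm_tsum_le_tsum_enorm.trans ?_
    refine ENNReal.tsum_le_tsum fun j => ?_
    rw [← ofReal_norm]
    apply ENNReal.ofReal_le_ofReal
    simp only [Function.comp]
    rw [e, norm_mul, Real.norm_of_nonneg (hr0 j)]
    simp only [ha]
    rw [mul_assoc]
    have := hr0 j
    gcongr
    refine (norm_inner_le_norm _ _).trans ?_
    have h3 := rs_norm_le hMp hβ (D ω (g j))
    calc _ ≤ ‖Dl ω (g j)‖ * (‖D ω (g j)‖ / β) := by gcongr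
      _ ≤ _ := by
        have : 0 ≤ (1 / (2 * β)) * (‖Dl ω (g j)‖ - ‖D ω (g j)‖) ^ 2 := by positivity
        have e2 : (1 / (2 * β)) * (‖Dl ω (g j)‖ - ‖D ω (g j)‖) ^ 2
          = 1 / (2 * β) * (‖Dl ω (g j)‖ ^ 2 + ‖D ω (g j)‖ ^ 2)
            - ‖Dl ω (g j)‖ * (‖D ω (g j)‖ / β) := by field_simp; ring
        linarith
  have hB := covOp_psd Q hφc hφ1
  set b : ι → ℝ := fun j => r j * (1 / (2 * β)) *
    (k⁻¹ * ⟪g j, mix φ α P Q (g j)⟫ + k⁻¹ * ⟪g j, covOp φ P (g j)⟫) with hb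
  have hb0 : ∀ j, 0 ≤ b j := fun j => by
    have := hr0 j
    have := hM.nonneg (g j)
    have := hA.nonneg (g j)
    simp only [hb]; positivity
  have hE : ∀ j, ∫⁻ ω, ENNReal.ofReal (a j ω) ∂μ ≤ ENNReal.ofReal (b j) := by
    intro j
    have hrj := hr0 j
    have q1 := hM.nonneg (g j)
    have q2 := hA.nonneg (g j)
    have v1 := Delta_var hS hφc hφ1 h0.le h1 (g j)
    have v2 := D_var hS.hn hS.px hS.hk hS.kn hφc hφ1 (g j)
    have hc1 : Continuous fun ω => ‖Dl ω (g j)‖ ^ 2 := by fun_prop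
    simp only [ha, hb]
    rw [ENNReal.ofReal_mul (by positivity), ENNReal.ofReal_add (by positivity) (by positivity)]
    have e : ∀ ω, ENNReal.ofReal (r j * (1 / (2 * β)) * (‖Dl ω (g j)‖ ^ 2 + ‖D ω (g j)‖ ^ 2))
        = ENNReal.ofReal (r j * (1 / (2 * β))) * (ENNReal.ofReal (‖Dl ω (g j)‖ ^ 2)
          + ENNReal.ofReal (‖D ω (g j)‖ ^ 2)) := fun ω => by
      rw [ENNReal.ofReal_mul (by positivity), ENNReal.ofReal_add (by positivity) (by positivity)]
    simp only [e]
    rw [lintegral_const_mul' _ _ ENNReal.ofReal_ne_top,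
      lintegral_add_left hc1.measurable.ennreal_ofReal]
    gcongr
    exact v2
  have hh : ∀ z, ⟪φ z, R (φ z)⟫ ≤ σ := fun z => (rs_mix_le hφc hφ1 h0.le h1 hβ _).trans (hσ z)
  have hsum : HasSum b (1 / (2 * β) * k⁻¹ *
      ((α * tr φ P R + (1 - α) * tr φ Q R) + tr φ P R)) := by
    have s1 := trace_hasSum P hφc hφ1 g R
    have s2 := trace_hasSum Q hφc hφ1 g R
    have e : ∀ (S : Measure (EuclideanSpace ℝ (Fin d))) [IsProbabilityMeasure S], ∀ j,
        ⟪g j, R (covOp φ S (g j))⟫ = r j * ⟪g j, covOp φ S (g j)⟫ := fun S _ j => by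
      rw [hR, ← rs_sym hM hβ, ← hR, hRg, inner_smul_left]; simp
    have s3 := (((s1.mul_left α).add (s2.mul_left (1 - α))).add s1).mul_left (1 / (2 * β) * k⁻¹)
    have e3 : b = fun j => 1 / (2 * β) * k⁻¹ * ((α * ⟪g j, R (covOp φ P (g j))⟫
        + (1 - α) * ⟪g j, R (covOp φ Q (g j))⟫) + ⟪g j, R (covOp φ P (g j))⟫) := by
      ext j
      simp only [hb, e, mix_inner]; ring
    rw [e3]
    exact s3
  calc _ ≤ ∫⁻ ω, ∑' j : J, ENNReal.ofReal (a j ω) ∂μ := lintegral_mono hpt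
    _ = ∑' j : J, ∫⁻ ω, ENNReal.ofReal (a j ω) ∂μ :=
        lintegral_tsum fun j => (hac j).measurable.ennreal_ofReal.aemeasurable
    _ ≤ ∑' j : J, ENNReal.ofReal (b j) := ENNReal.tsum_le_tsum fun j => hE j
    _ ≤ ∑' j, ENNReal.ofReal (b j) :=
        ENNReal.tsum_comp_le_tsum_of_injective Subtype.val_injective fun j => ENNReal.ofReal (b j)
    _ = ENNReal.ofReal (∑' j, b j) := (ENNReal.ofReal_tsum_of_nonneg hb0 hsum.summable).symm
    _ ≤ _ := by
        rw [hsum.tsum_eq]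
        apply ENNReal.ofReal_le_ofReal
        have p1 : tr φ P R ≤ σ := integral_le_of_le P hσ0.le hh
        have p2 : tr φ Q R ≤ σ := integral_le_of_le Q hσ0.le hh
        have p3 : (1 - α) * tr φ Q R ≤ (1 - α) * σ := by
          have : 0 ≤ 1 - α := by linarith
          gcongr
        have p4 : α * tr φ P R ≤ α * σ := by gcongr
        calc _ ≤ 1 / (2 * β) * k⁻¹ * (2 * σ) := by
              gcongr; linarith
          _ = _ := by field_simp

theorem rs_cont_fixed {Z : Type*} [TopologicalSpace Z] (X : Z → H →L[ℝ] H) (hX : Continuous X)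
    (hp : ∀ z, Psd (X z)) {β : ℝ} (hβ : 0 < β) : Continuous fun z => rs (X z) β := by
  have h1 := rs_continuousOn X hX hp
  have h2 : Continuous fun z : Z => ((z, β) : Z × ℝ) := by fun_prop
  have h3 := h1.comp_continuous h2 (fun z => Set.mem_prod.2 ⟨Set.mem_univ _, hβ⟩)
  exact h3

set_option maxHeartbeats 1000000 in
theorem bound_II {ι : Type*} (hS : Smp μ P Q xs ys k) (hφc : Continuous φ)
    (hφ1 : ∀ x, ‖φ x‖ = 1)
    {α β σ s : ℝ} (h0 : 0 < α) (h1 : α ≤ 1) (hβ : 0 < β) (g : HilbertBasis ι ℝ H) {gam : ι → ℝ}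
    (hg : ∀ j, mix φ α P Q (g j) = gam j • g j) (hgam : ∀ j, 0 ≤ gam j) (hσ0 : 0 < σ)
    (hσ : ∀ x, ⟪φ x, rs (α • covOp φ P) β (φ x)⟫ ≤ σ) (hs : s = σ ∨ s = 1 / β ^ 2) :
    ∫⁻ ω, ENNReal.ofReal |tr φ (empMeas (xs ω)) (rs (mix φ α (empMeas (xs ω)) (empMeas (ys ω))) β)
      - tr φ P (rs (mix φ α P Q) β)| ∂μ
      ≤ ENNReal.ofReal (2 * (σ / (k * β)) + 3 * (s / √(α * k))) := by
  have hM := mix_psd P Q hφc hφ1 h0.le h1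
  have hk := hS.hk
  have hs0 : 0 < s := by rcases hs with rfl | rfl <;> positivity
  have bt1 := t1_bound hS hφc hφ1 h0 h1 hβ hσ0 hσ hs
  have bt2 := t2_bound hS hφc hφ1 h0 h1 hβ hσ0 hσ hs
  have bt4 := t4_bound hS hφc hφ1 h0 h1 hβ hσ0 hσ
  have bY := Y_bound hS hφc hφ1 h0 h1 hβ g hg hgam hσ0 hσ
  have hcont := mix_emp_continuous hS hφc α
  set R := rs (mix φ α P Q) β with hR
  set M' : Ω → H →L[ℝ] H := fun ω => mix φ α (empMeas (xs ω)) (empMeas (ys ω)) with hM'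
  set Dl : Ω → H →L[ℝ] H := fun ω => mix φ α P Q - M' ω with hDl
  have hDlc : Continuous Dl := by fun_prop
  set f1 : Ω → ℝ := fun ω => tr φ (empMeas (xs ω)) R - tr φ P R with hf1
  set f2 : Ω → ℝ := fun ω => ∫ x, ⟪R (φ x), Dl ω (R (φ x))⟫ ∂P with hf2
  set f4 : Ω → ℝ := fun ω => ∫ x, ⟪Dl ω (R (φ x)), rs (M' ω) β (Dl ω (R (φ x)))⟫ ∂P with hf4
  set fY : Ω → ℝ := fun ω => (tr φ (empMeas (xs ω)) (rs (M' ω) β) - tr φ (empMeas (xs ω)) R)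
    - (tr φ P (rs (M' ω) β) - tr φ P R) with hfY
  have hf1c : Continuous f1 := by
    have := hS.cx
    simp only [hf1, tr, empMeas_integral]
    fun_prop
  have hf2e : f2 = fun ω => tr φ P (R ∘L Dl ω ∘L R) := by
    ext ω
    simp only [hf2, tr, ContinuousLinearMap.comp_apply]
    congr 1; ext x
    rw [hR, rs_sym hM hβ]
  have hf2c : Continuous f2 := by
    rw [hf2e]
    exact (tr_continuous P hφc hφ1).comp (by fun_prop)
  have hMp : ∀ ω, Psd (M' ω) := fun ω => by
    have := empMeas_prob hS.hn (xs ω)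
    have := empMeas_prob hS.hm (ys ω)
    exact mix_psd (empMeas (xs ω)) (empMeas (ys ω)) hφc hφ1 h0.le h1
  have hsymD : ∀ ω u w, ⟪Dl ω u, w⟫ = ⟪u, Dl ω w⟫ := fun ω u w => by
    simp [hDl, inner_sub_left, inner_sub_right, hM.sym, (hMp ω).sym]
  have hf4e : f4 = fun ω => tr φ P (R ∘L Dl ω ∘L rs (M' ω) β ∘L Dl ω ∘L R) := by
    ext ω
    simp only [hf4, tr, ContinuousLinearMap.comp_apply]
    congr 1; ext x
    rw [hsymD, hR, rs_sym hM hβ]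
  have hf24 : ∀ ω, tr φ P (rs (M' ω) β) - tr φ P R = f2 ω + f4 ω := by
    intro ω
    rw [hf2e, hf4e]
    simp only [tr]
    rw [← integral_sub (quad_integrable P hφc hφ1 _) (quad_integrable P hφc hφ1 _),
      ← integral_add (quad_integrable P hφc hφ1 _) (quad_integrable P hφc hφ1 _)]
    congr 1; ext x
    have e := quad_expand hM (hMp ω) hβ (φ x)
    simp only [ContinuousLinearMap.comp_apply]
    have e1 : ⟪φ x, R (Dl ω (R (φ x)))⟫ = ⟪R (φ x), Dl ω (R (φ x))⟫ := (rs_sym hM hβ _ _).symm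
    have e2 : ⟪φ x, R (Dl ω (rs (M' ω) β (Dl ω (R (φ x)))))⟫
        = ⟪Dl ω (R (φ x)), rs (M' ω) β (Dl ω (R (φ x)))⟫ := by
      rw [hsymD]; exact (rs_sym hM hβ _ _).symm
    rw [e1, e2]
    exact e
  have hrc : Continuous fun ω => rs (M' ω) β := by
    exact rs_cont_fixed M' hcont hMp hβ
  have hf4c : Continuous f4 := by
    rw [hf4e]
    have hcc : Continuous fun ω => R ∘L Dl ω ∘L rs (M' ω) β ∘L Dl ω ∘L R :=
      continuous_const.clm_comp (hDlc.clm_comp (hrc.clm_comp (hDlc.clm_comp continuous_const)))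
    exact (tr_continuous P hφc hφ1).comp hcc
  have hsum : ∀ ω, tr φ (empMeas (xs ω)) (rs (M' ω) β) - tr φ P R
      = f1 ω + (f2 ω + (f4 ω + fY ω)) := by
    intro ω
    have := hf24 ω
    simp only [hf1, hfY]
    linarith
  have hsqrt : √(α * k) = √α * √k := Real.sqrt_mul h0.le k
  have hsα : 0 < √α := Real.sqrt_pos.2 h0
  have hsα1 : √α ≤ 1 := Real.sqrt_le_one.2 h1
  have hsk : 0 < √k := Real.sqrt_pos.2 hk
  calc _ ≤ ∫⁻ ω, (ENNReal.ofReal |f1 ω| + (ENNReal.ofReal |f2 ω|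
        + (ENNReal.ofReal |f4 ω| + ENNReal.ofReal |fY ω|))) ∂μ := by
        refine lintegral_mono fun ω => ?_
        rw [← ENNReal.ofReal_add (by positivity) (by positivity),
          ← ENNReal.ofReal_add (by positivity) (by positivity),
          ← ENNReal.ofReal_add (by positivity) (by positivity)]
        apply ENNReal.ofReal_le_ofReal
        change |tr φ (empMeas (xs ω)) (rs (M' ω) β) - tr φ P R| ≤ _
        rw [hsum]
        have a1 := abs_add_le (f1 ω) (f2 ω + (f4 ω + fY ω))
        have a2 := abs_add_le (f2 ω) (f4 ω + fY ω)
        have a3 := abs_add_le (f4 ω) (fY ω)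
        linarith
    _ = ∫⁻ ω, ENNReal.ofReal |f1 ω| ∂μ + (∫⁻ ω, ENNReal.ofReal |f2 ω| ∂μ
        + (∫⁻ ω, ENNReal.ofReal |f4 ω| ∂μ + ∫⁻ ω, ENNReal.ofReal |fY ω| ∂μ)) := by
        rw [lintegral_add_left hf1c.abs.measurable.ennreal_ofReal,
          lintegral_add_left hf2c.abs.measurable.ennreal_ofReal,
          lintegral_add_left hf4c.abs.measurable.ennreal_ofReal]
    _ ≤ ENNReal.ofReal (s / √k) + (ENNReal.ofReal (2 * (s / √(α * k)))
        + (ENNReal.ofReal (σ / (k * β)) + ENNReal.ofReal (σ / (k * β)))) :=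
        add_le_add bt1 (add_le_add bt2 (add_le_add bt4 bY))
    _ ≤ _ := by
        rw [← ENNReal.ofReal_add (by positivity) (by positivity),
          ← ENNReal.ofReal_add (by positivity) (by positivity),
          ← ENNReal.ofReal_add (by positivity) (by positivity)]
        apply ENNReal.ofReal_le_ofReal
        have : s / √k ≤ s / √(α * k) := by
          rw [hsqrt]
          gcongr
          exact mul_le_of_le_one_left hsk.le hsα1
        linarith

end FixedThree

theorem u_integral {a : ℝ} (ha : 0 < a) :
    IntegrableOn (fun β : ℝ => a ^ 2 / (β + a) ^ 2) (Set.Ioi 0) ∧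
      ∫ β in Set.Ioi (0 : ℝ), a ^ 2 / (β + a) ^ 2 = a := by
  have hd : ∀ x ∈ Set.Ici (0 : ℝ), HasDerivAt (fun β : ℝ => -(a ^ 2 * (β + a)⁻¹))
      (a ^ 2 / (x + a) ^ 2) x := by
    intro x hx
    have hx0 : (0 : ℝ) ≤ x := hx
    have hxa : x + a ≠ 0 := by positivity
    have h := ((((hasDerivAt_id x).add_const a).inv hxa).const_mul (a ^ 2)).neg
    have e : a ^ 2 / (x + a) ^ 2 = -(a ^ 2 * (-1 / (x + a) ^ 2)) := by ring
    rw [e]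
    exact h
  have hlim : Filter.Tendsto (fun β : ℝ => -(a ^ 2 * (β + a)⁻¹)) Filter.atTop (nhds 0) := by
    have h1 : Filter.Tendsto (fun β : ℝ => β + a) Filter.atTop Filter.atTop :=
      Filter.tendsto_atTop_add_const_right _ _ Filter.tendsto_id
    have h2 := ((tendsto_inv_atTop_zero.comp h1).const_mul (a ^ 2)).neg
    simpa using h2
  have hpos : ∀ x ∈ Set.Ioi (0 : ℝ), 0 ≤ a ^ 2 / (x + a) ^ 2 := fun x _ => by positivity
  refine ⟨integrableOn_Ioi_deriv_of_nonneg' hd hpos hlim, ?_⟩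
  rw [integral_Ioi_of_hasDerivAt_of_nonneg' hd hpos hlim]
  field_simp
  ring

section Main

variable {d n m : ℕ} {Ω : Type*} [MeasurableSpace Ω] [TopologicalSpace Ω]
  [SecondCountableTopology Ω] [OpensMeasurableSpace Ω]
variable {μ : Measure Ω} [IsProbabilityMeasure μ]
variable {P Q : Measure (EuclideanSpace ℝ (Fin d))} [IsProbabilityMeasure P]
  [IsProbabilityMeasure Q]
variable {xs : Ω → Fin n → EuclideanSpace ℝ (Fin d)} {ys : Ω → Fin m → EuclideanSpace ℝ (Fin d)}
variable {k : ℝ}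
variable {H : Type u} [NormedAddCommGroup H] [InnerProductSpace ℝ H] [CompleteSpace H]
variable {φ : EuclideanSpace ℝ (Fin d) → H}

theorem T_cont (hS : Smp μ P Q xs ys k) (hφc : Continuous φ) (hφ1 : ∀ x, ‖φ x‖ = 1)
    {α : ℝ} (h0 : 0 < α) (h1 : α ≤ 1) :
    ContinuousOn (fun z : Ω × ℝ =>
      tr φ (empMeas (xs z.1)) (rs (mix φ α (empMeas (xs z.1)) (empMeas (ys z.1))) z.2)
      - tr φ P (rs (mix φ α P Q) z.2)) (Set.univ ×ˢ Set.Ioi 0) := by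
  have hMp : ∀ ω, Psd (mix φ α (empMeas (xs ω)) (empMeas (ys ω))) := fun ω => by
    have := empMeas_prob hS.hn (xs ω)
    have := empMeas_prob hS.hm (ys ω)
    exact mix_psd (empMeas (xs ω)) (empMeas (ys ω)) hφc hφ1 h0.le h1
  have c1 := rs_continuousOn (fun ω => mix φ α (empMeas (xs ω)) (empMeas (ys ω)))
    (mix_emp_continuous hS hφc α) hMp
  have c2 := rs_continuousOn (fun _ : Ω => mix φ α P Q) continuous_const
    (fun _ => mix_psd P Q hφc hφ1 h0.le h1)
  have c3 := (tr_continuous P hφc hφ1).comp_continuousOn c2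
  have hx := hS.cx
  refine ContinuousOn.sub ?_ c3
  simp only [tr, empMeas_integral]
  have hxi : ∀ i, Continuous fun z : Ω × ℝ => φ (xs z.1 i) := fun i => by fun_prop
  have c4 : ContinuousOn (fun z : Ω × ℝ => ∑ i, ⟪φ (xs z.1 i),
      rs (mix φ α (empMeas (xs z.1)) (empMeas (ys z.1))) z.2 (φ (xs z.1 i))⟫)
      (Set.univ ×ˢ Set.Ioi 0) :=
    continuousOn_finsetSum _ fun i _ =>
      (hxi i).continuousOn.inner (𝕜 := ℝ) (c1.clm_apply (hxi i).continuousOn)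
  simp only [smul_eq_mul]
  exact continuousOn_const.mul c4

theorem T_meas (hS : Smp μ P Q xs ys k) (hφc : Continuous φ) (hφ1 : ∀ x, ‖φ x‖ = 1)
    {α : ℝ} (h0 : 0 < α) (h1 : α ≤ 1) :
    AEMeasurable (fun z : Ω × ℝ => ENNReal.ofReal
      |tr φ (empMeas (xs z.1)) (rs (mix φ α (empMeas (xs z.1)) (empMeas (ys z.1))) z.2)
      - tr φ P (rs (mix φ α P Q) z.2)|) (μ.prod (volume.restrict (Set.Ioi 0))) := by
  have h := (T_cont hS hφc hφ1 h0 h1).abs.aemeasurable (μ := μ.prod volume)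
    (MeasurableSet.univ.prod measurableSet_Ioi)
  rw [← Measure.prod_restrict, Measure.restrict_univ] at h
  exact h.ennreal_ofReal

/-- pointwise scale bound -/
theorem pt_bound {ι ι' : Type*} (hS : Smp μ P Q xs ys k) (hφc : Continuous φ)
    (hφ1 : ∀ x, ‖φ x‖ = 1)
    {α β σ t : ℝ} (h0 : 0 < α) (h1 : α ≤ 1) (hβ : 0 < β) (ht : 0 < t)
    (f : HilbertBasis ι ℝ H) {lam : ι → ℝ}
    (hf : ∀ i, covOp φ P (f i) = lam i • f i) (hlam : ∀ i, 0 ≤ lam i)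
    (g : HilbertBasis ι' ℝ H) {gam : ι' → ℝ}
    (hg : ∀ j, mix φ α P Q (g j) = gam j • g j) (hgam : ∀ j, 0 ≤ gam j)
    (hσ1 : 1 / (1 + β) ≤ σ)
    (hσ : ∀ x, ⟪φ x, rs (α • covOp φ P) β (φ x)⟫ ≤ σ) :
    ∫⁻ ω, ENNReal.ofReal |tr φ (empMeas (xs ω)) (rs (mix φ α (empMeas (xs ω)) (empMeas (ys ω))) β)
      - tr φ P (rs (mix φ α P Q) β)| ∂μ
      ≤ ENNReal.ofReal (t / 2 * σ ^ 2 + 1 / (2 * t) * (32 * ((1 / k) ^ 2 / (β + 1 / k) ^ 2)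
          + 288 / (α * k) * (1 ^ 2 / (β + 1) ^ 2))) := by
  have hk := hS.hk
  have hσ0 : 0 < σ := lt_of_lt_of_le (by positivity) hσ1
  have young : ∀ ρ r : ℝ, ρ ^ 2 ≤ r → ρ * σ ≤ t / 2 * σ ^ 2 + 1 / (2 * t) * r := by
    intro ρ r hr
    have e : t / 2 * σ ^ 2 + 1 / (2 * t) * ρ ^ 2 - ρ * σ = 1 / (2 * t) * (t * σ - ρ) ^ 2 := by
      field_simp
      ring
    have e2 : 0 ≤ 1 / (2 * t) * (t * σ - ρ) ^ 2 := by positivity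
    have e3 : 1 / (2 * t) * ρ ^ 2 ≤ 1 / (2 * t) * r := by gcongr
    linarith
  have hu : ∀ a : ℝ, 0 < a → β ≤ a → 1 ≤ 4 * (a ^ 2 / (β + a) ^ 2) := by
    intro a ha hba
    rw [← mul_div_assoc, le_div_iff₀ (by positivity)]
    nlinarith
  have hu2 : ∀ a : ℝ, 0 < a → a ≤ β → (a / β) ^ 2 ≤ 4 * (a ^ 2 / (β + a) ^ 2) := by
    intro a ha hba
    rw [← mul_div_assoc, div_pow, div_le_div_iff₀ (by positivity) (by positivity)]
    nlinarith [mul_pos ha ha, mul_pos ha hβ, mul_le_mul_of_nonneg_left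
      (show (β + a) ^ 2 ≤ 4 * β ^ 2 by nlinarith) (sq_nonneg a)]
  have hk1 : 0 < 1 / k := by positivity
  set U := (1 / k) ^ 2 / (β + 1 / k) ^ 2 with hU
  set W := (1 : ℝ) ^ 2 / (β + 1) ^ 2 with hW
  have hU0 : 0 ≤ U := by positivity
  have hW0 : 0 ≤ W := by positivity
  have hc0 : 0 < α * k := by positivity
  rcases le_total β (1 / k) with hb | hb
  · refine (bound_I hS hφc hφ1 h0 h1 hβ f hf hlam hσ0 hσ).trans (ENNReal.ofReal_le_ofReal ?_)
    apply young
    have := hu _ hk1 hb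
    have : 0 ≤ 288 / (α * k) * W := by positivity
    linarith
  · have hr1 : (2 * ((1 / k) / β)) ^ 2 ≤ 16 * U := by
      have := hu2 _ hk1 hb
      rw [mul_pow]; linarith
    have comb : ∀ τ : ℝ, τ ^ 2 ≤ 16 * W →
        (2 * ((1 / k) / β) + 3 * (τ / √(α * k))) ^ 2 ≤ 32 * U + 288 / (α * k) * W := by
      intro τ hτ
      have e1 : (3 * (τ / √(α * k))) ^ 2 ≤ 144 / (α * k) * W := by
        rw [mul_pow, div_pow, Real.sq_sqrt hc0.le]
        have : τ ^ 2 / (α * k) ≤ 16 * W / (α * k) := by gcongr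
        calc _ ≤ 3 ^ 2 * (16 * W / (α * k)) := by gcongr
          _ = _ := by ring
      have e2 : 288 / (α * k) * W = 2 * (144 / (α * k) * W) := by ring
      rw [e2]
      nlinarith [sq_nonneg (2 * ((1 / k) / β) - 3 * (τ / √(α * k)))]
    rcases le_total β 1 with hb1 | hb1
    · refine (bound_II hS hφc hφ1 h0 h1 hβ g hg hgam hσ0 hσ (s := σ) (Or.inl rfl)).trans
        (ENNReal.ofReal_le_ofReal ?_)
      refine le_trans (le_of_eq ?_) (young _ _ (comb 1 ?_))
      · field_simp
      · have := hu 1 one_pos hb1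
        linarith
    · refine (bound_II hS hφc hφ1 h0 h1 hβ g hg hgam hσ0 hσ (s := 1 / β ^ 2) (Or.inr rfl)).trans
        (ENNReal.ofReal_le_ofReal ?_)
      refine le_trans ?_ (young _ _ (comb (2 * (1 / β)) ?_))
      · have h3 : 1 / β ^ 2 ≤ 2 * (1 / β) * σ := by
          have : 1 / β ^ 2 ≤ 2 * (1 / β) * (1 / (1 + β)) := by
            rw [div_le_iff₀ (by positivity)]
            field_simp
            linarith
          refine this.trans ?_
          gcongr
        have h4 : 3 * (1 / β ^ 2 / √(α * k)) ≤ 3 * (2 * (1 / β) * σ / √(α * k)) := by gcongr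
        refine (add_le_add_right h4 _).trans (le_of_eq ?_)
        field_simp
      · have := hu2 1 one_pos hb1
        rw [mul_pow]
        linarith

theorem main_bound {ι ι' : Type*} (hS : Smp μ P Q xs ys k) (hφc : Continuous φ)
    (hφ1 : ∀ x, ‖φ x‖ = 1)
    {α C : ℝ} (h0 : 0 < α) (h1 : α ≤ 1)
    (f : HilbertBasis ι ℝ H) {lam : ι → ℝ}
    (hf : ∀ i, covOp φ P (f i) = lam i • f i) (hlam : ∀ i, 0 ≤ lam i)
    (g : HilbertBasis ι' ℝ H) {gam : ι' → ℝ}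
    (hg : ∀ j, mix φ α P Q (g j) = gam j • g j) (hgam : ∀ j, 0 ≤ gam j)
    (s : ℝ → ℝ) (hs1 : ∀ β > 0, 1 / (1 + β) ≤ s β)
    (hs : ∀ β > 0, ∀ x, ⟪φ x, rs (α • covOp φ P) β (φ x)⟫ ≤ s β)
    (hsi : IntegrableOn (fun β => s β ^ 2) (Set.Ioi 0)) (hC0 : 0 < C)
    (hC : ∫ β in Set.Ioi (0 : ℝ), s β ^ 2 = C) :
    ∫⁻ ω, (∫⁻ β in Set.Ioi (0 : ℝ), ENNReal.ofReal
      |tr φ (empMeas (xs ω)) (rs (mix φ α (empMeas (xs ω)) (empMeas (ys ω))) β)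
      - tr φ P (rs (mix φ α P Q) β)|) ∂μ
      ≤ ENNReal.ofReal (32 * (√C / √(α * k))) := by
  have hk := hS.hk
  have hc0 : 0 < α * k := by positivity
  have hsC : 0 < √C := Real.sqrt_pos.2 hC0
  have hsa : 0 < √(α * k) := Real.sqrt_pos.2 hc0
  set t : ℝ := 18 / (√C * √(α * k)) with ht
  have ht0 : 0 < t := by positivity
  obtain ⟨iU, eU⟩ := u_integral (a := 1 / k) (by positivity)
  obtain ⟨iW, eW⟩ := u_integral (a := 1) one_pos
  rw [lintegral_lintegral_swap (T_meas hS hφc hφ1 h0 h1)]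
  have iA : IntegrableOn (fun β => t / 2 * s β ^ 2) (Set.Ioi 0) := hsi.const_mul _
  have iU' : IntegrableOn (fun β : ℝ => 32 * ((1 / k) ^ 2 / (β + 1 / k) ^ 2)) (Set.Ioi 0) :=
    iU.const_mul _
  have iW' : IntegrableOn (fun β : ℝ => 288 / (α * k) * ((1 : ℝ) ^ 2 / (β + 1) ^ 2)) (Set.Ioi 0) :=
    iW.const_mul _
  have iUW : IntegrableOn (fun β : ℝ => 32 * ((1 / k) ^ 2 / (β + 1 / k) ^ 2)
      + 288 / (α * k) * ((1 : ℝ) ^ 2 / (β + 1) ^ 2)) (Set.Ioi 0) := iU'.add iW'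
  have iB : IntegrableOn (fun β : ℝ => 1 / (2 * t) * (32 * ((1 / k) ^ 2 / (β + 1 / k) ^ 2)
      + 288 / (α * k) * ((1 : ℝ) ^ 2 / (β + 1) ^ 2))) (Set.Ioi 0) := iUW.const_mul _
  have iS : IntegrableOn (fun β : ℝ => t / 2 * s β ^ 2 + 1 / (2 * t) *
      (32 * ((1 / k) ^ 2 / (β + 1 / k) ^ 2)
      + 288 / (α * k) * ((1 : ℝ) ^ 2 / (β + 1) ^ 2))) (Set.Ioi 0) := iA.add iB
  calc _ ≤ ∫⁻ β in Set.Ioi (0 : ℝ), ENNReal.ofReal (t / 2 * s β ^ 2 + 1 / (2 * t) *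
      (32 * ((1 / k) ^ 2 / (β + 1 / k) ^ 2)
      + 288 / (α * k) * ((1 : ℝ) ^ 2 / (β + 1) ^ 2))) :=
        setLIntegral_mono' measurableSet_Ioi fun β hβ =>
          pt_bound hS hφc hφ1 h0 h1 hβ ht0 f hf hlam g hg hgam (hs1 β hβ) (hs β hβ)
    _ = ENNReal.ofReal (∫ β in Set.Ioi (0 : ℝ), (t / 2 * s β ^ 2 + 1 / (2 * t) *
      (32 * ((1 / k) ^ 2 / (β + 1 / k) ^ 2)
      + 288 / (α * k) * ((1 : ℝ) ^ 2 / (β + 1) ^ 2)))) := by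
        refine (ofReal_integral_eq_lintegral_ofReal iS ?_).symm
        filter_upwards with β
        positivity
    _ ≤ _ := by
        apply ENNReal.ofReal_le_ofReal
        rw [integral_add iA iB, integral_const_mul, integral_const_mul, integral_add iU' iW',
          integral_const_mul, integral_const_mul, eU, eW, hC]
        have hak : 32 * (1 / k) + 288 / (α * k) * 1 ≤ 320 / (α * k) := by
          have : 32 * (1 / k) ≤ 32 / (α * k) := by
            rw [mul_one_div]
            gcongr
            exact mul_le_of_le_one_left hk.le h1
          calc _ ≤ 32 / (α * k) + 288 / (α * k) * 1 := by gcongr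
            _ = _ := by ring
        have hX : 0 < √C / √(α * k) := by positivity
        have e1 : t / 2 * C = 9 * (√C / √(α * k)) := by
          rw [ht]
          nth_rewrite 2 [← Real.sq_sqrt hC0.le]
          field_simp
          norm_num
        have e2 : 1 / (2 * t) * (320 / (α * k)) = 80 / 9 * (√C / √(α * k)) := by
          rw [ht]
          nth_rewrite 2 [← Real.sq_sqrt hc0.le]
          field_simp
          norm_num
        have e3 : 1 / (2 * t) * (32 * (1 / k) + 288 / (α * k) * 1) ≤ 1 / (2 * t) * (320 / (α * k)) := by
          gcongr
        rw [e1]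
        linarith

end Main

section Last

variable {d n m : ℕ} {Ω : Type*} [MeasurableSpace Ω] [TopologicalSpace Ω]
  [SecondCountableTopology Ω] [OpensMeasurableSpace Ω]
variable {μ : Measure Ω} [IsProbabilityMeasure μ]
variable {P Q : Measure (EuclideanSpace ℝ (Fin d))} [IsProbabilityMeasure P]
  [IsProbabilityMeasure Q]
variable {xs : Ω → Fin n → EuclideanSpace ℝ (Fin d)} {ys : Ω → Fin m → EuclideanSpace ℝ (Fin d)}
variable {k : ℝ}
variable {H : Type u} [NormedAddCommGroup H] [InnerProductSpace ℝ H] [CompleteSpace H]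
variable {φ : EuclideanSpace ℝ (Fin d) → H}

theorem S_facts (hφc : Continuous φ) (hφ1 : ∀ x, ‖φ x‖ = 1) {Rp : ℝ → H →L[ℝ] H}
    (hRp : ∀ β > (0 : ℝ), Rp β ∘L (covOp φ P + β • 1) = 1 ∧
      (covOp φ P + β • 1) ∘L Rp β = 1) {β : ℝ} (hβ : 0 < β) :
    (∀ x, ⟪φ x, rs (covOp φ P) β (φ x)⟫
      ≤ ⨆ x : EuclideanSpace ℝ (Fin d), ⟪φ x, Rp β (φ x)⟫) ∧
    1 / (1 + β) ≤ ⨆ x : EuclideanSpace ℝ (Fin d), ⟪φ x, Rp β (φ x)⟫ := by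
  have hA := covOp_psd P hφc hφ1
  have e : ∀ v, Rp β v = rs (covOp φ P) β v := fun v => by
    symm
    apply rs_eq_of hA hβ
    have h := DFunLike.congr_fun (hRp β hβ).2 v
    simpa using h
  simp only [e]
  have hle : ∀ x, ⟪φ x, rs (covOp φ P) β (φ x)⟫
      ≤ ⨆ x : EuclideanSpace ℝ (Fin d), ⟪φ x, rs (covOp φ P) β (φ x)⟫ := by
    intro x
    refine le_ciSup (f := fun x => ⟪φ x, rs (covOp φ P) β (φ x)⟫) ⟨1 / β, ?_⟩ x
    rintro _ ⟨y, rfl⟩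
    have := rs_quad_le hA hβ (φ y)
    rwa [hφ1, one_pow] at this
  refine ⟨hle, ?_⟩
  refine le_trans ?_ (hle 0)
  have h := rs_var hA hβ (φ 0) ((1 / (1 + β)) • φ 0)
  have h2 := covOp_quad_le P hφc hφ1 ((1 / (1 + β)) • φ 0)
  have h3 : ‖(1 / (1 + β)) • φ 0‖ = 1 / (1 + β) := by
    rw [norm_smul, hφ1, mul_one, Real.norm_of_nonneg (by positivity)]
  have h4 : ⟪(1 / (1 + β)) • φ 0, φ 0⟫ = 1 / (1 + β) := by
    rw [real_inner_smul_left, real_inner_self_eq_norm_sq, hφ1]; simp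
  rw [h3] at h h2
  rw [h4] at h
  have h5 : (1 / (1 + β)) ^ 2 + β * (1 / (1 + β)) ^ 2 = 1 / (1 + β) := by
    field_simp
  linarith

theorem c_pos (hφc : Continuous φ) (hφ1 : ∀ x, ‖φ x‖ = 1) {Rp : ℝ → H →L[ℝ] H}
    (hRp : ∀ β > (0 : ℝ), Rp β ∘L (covOp φ P + β • 1) = 1 ∧
      (covOp φ P + β • 1) ∘L Rp β = 1)
    (hcfin : IntegrableOn
      (fun β => (⨆ x : EuclideanSpace ℝ (Fin d), ⟪φ x, Rp β (φ x)⟫) ^ 2)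
      (Set.Ioi (0 : ℝ))) :
    0 < ∫ β in Set.Ioi (0 : ℝ),
      (⨆ x : EuclideanSpace ℝ (Fin d), ⟪φ x, Rp β (φ x)⟫) ^ 2 := by
  obtain ⟨i1, e1⟩ := u_integral (a := 1) one_pos
  have := setIntegral_mono_on i1 hcfin measurableSet_Ioi fun β (hβ : 0 < β) => by
    have h := (S_facts hφc hφ1 hRp hβ).2
    have h2 : (1 : ℝ) ^ 2 / (β + 1) ^ 2 = (1 / (1 + β)) ^ 2 := by rw [div_pow, add_comm]
    rw [h2]
    gcongr
  linarith

theorem main_S {ι ι' : Type*} (hS : Smp μ P Q xs ys k) (hφc : Continuous φ)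
    (hφ1 : ∀ x, ‖φ x‖ = 1)
    {α c : ℝ} (h0 : 0 < α) (h1 : α ≤ 1)
    (f : HilbertBasis ι ℝ H) {lam : ι → ℝ}
    (hf : ∀ i, covOp φ P (f i) = lam i • f i) (hlam : ∀ i, 0 ≤ lam i)
    (g : HilbertBasis ι' ℝ H) {gam : ι' → ℝ}
    (hg : ∀ j, mix φ α P Q (g j) = gam j • g j) (hgam : ∀ j, 0 ≤ gam j)
    {Rp : ℝ → H →L[ℝ] H}
    (hRp : ∀ β > (0 : ℝ), Rp β ∘L (covOp φ P + β • 1) = 1 ∧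
      (covOp φ P + β • 1) ∘L Rp β = 1)
    (hc : c = ∫ β in Set.Ioi (0 : ℝ),
      (⨆ x : EuclideanSpace ℝ (Fin d), ⟪φ x, Rp β (φ x)⟫) ^ 2)
    (hcfin : IntegrableOn
      (fun β => (⨆ x : EuclideanSpace ℝ (Fin d), ⟪φ x, Rp β (φ x)⟫) ^ 2)
      (Set.Ioi (0 : ℝ))) :
    ∫⁻ ω, (∫⁻ β in Set.Ioi (0 : ℝ), ENNReal.ofReal
      |tr φ (empMeas (xs ω)) (rs (mix φ α (empMeas (xs ω)) (empMeas (ys ω))) β)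
      - tr φ P (rs (mix φ α P Q) β)|) ∂μ
      ≤ ENNReal.ofReal (32 * (√c / (α * √k))) := by
  have hA := covOp_psd P hφc hφ1
  have hk := hS.hk
  have hc0 : 0 < c := hc ▸ c_pos hφc hφ1 hRp hcfin
  have hSf := fun (β : ℝ) (hβ : 0 < β) => S_facts hφc hφ1 hRp hβ
  set S : ℝ → ℝ := fun β => ⨆ x : EuclideanSpace ℝ (Fin d), ⟪φ x, Rp β (φ x)⟫ with hSd
  have hai : 0 < α⁻¹ := inv_pos.2 h0
  have key := main_bound (C := c / α) hS hφc hφ1 h0 h1 f hf hlam g hg hgam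
    (fun β => α⁻¹ * S (α⁻¹ * β)) ?_ ?_ ?_ (by positivity) ?_
  · refine key.trans (le_of_eq ?_)
    congr 2
    rw [Real.sqrt_div hc0.le, Real.sqrt_mul h0.le, div_div, ← mul_assoc,
      Real.mul_self_sqrt h0.le]
  · intro β hβ
    have h := (hSf (α⁻¹ * β) (by positivity)).2
    calc 1 / (1 + β) ≤ 1 / (α + β) := by gcongr
      _ = α⁻¹ * (1 / (1 + α⁻¹ * β)) := by field_simp
      _ ≤ _ := by gcongr
  · intro β hβ x
    have h := (hSf (α⁻¹ * β) (by positivity)).1 x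
    rw [rs_smul hA h0 hβ, real_inner_smul_right, div_eq_inv_mul]
    gcongr
  · simp only [mul_pow]
    refine Integrable.const_mul ?_ _
    have := (integrableOn_Ioi_comp_mul_left_iff (fun β => S β ^ 2) 0 hai).2
      (by rw [mul_zero]; exact hcfin)
    exact this
  · simp only [mul_pow]
    rw [integral_const_mul, integral_comp_mul_left_Ioi (fun β => S β ^ 2) 0 hai, mul_zero,
      ← hc, smul_eq_mul, inv_inv]
    field_simp

end Last

/-- **Finite-sample concentration of the regularized kernel KL divergence, without
absolute continuity.**  If `α ∈ (0,1)` and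
`c = ∫₀^∞ sup_x ⟪φ(x), (Σ_p + βI)⁻¹ φ(x)⟫² dβ < ∞`, then for empirical measures on
`n` i.i.d. samples of `p` and `m` i.i.d. samples of `q`,
`E|KKL_α(p̂‖q̂) - KKL_α(p‖q)| ≤ (32/(α√(m∧n))) (2√c + log n)
  + (2/(m∧n)) (1/α + (c(26 log n)²/α²)(1 + n/(m∧n)))`. -/
theorem kkl_alpha_empirical_bound_no_ac {d n m : ℕ} (hn : 0 < n) (hm : 0 < m)
    {H : Type u} [NormedAddCommGroup H] [InnerProductSpace ℝ H] [CompleteSpace H]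
    (k : EuclideanSpace ℝ (Fin d) → EuclideanSpace ℝ (Fin d) → ℝ)
    (φ : EuclideanSpace ℝ (Fin d) → H) (hφc : Continuous φ)
    (hk : ∀ x y, k x y = ⟪φ x, φ y⟫) (hk1 : ∀ x, k x x = 1)
    (p q : Measure (EuclideanSpace ℝ (Fin d)))
    [IsProbabilityMeasure p] [IsProbabilityMeasure q]
    (α : ℝ) (hα : α ∈ Set.Ioo (0 : ℝ) 1)
    (Rp : ℝ → H →L[ℝ] H)
    (hRp : ∀ β > (0 : ℝ), Rp β ∘L (covOp φ p + β • 1) = 1 ∧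
      (covOp φ p + β • 1) ∘L Rp β = 1)
    (c : ℝ)
    (hc : c = ∫ β in Set.Ioi (0 : ℝ),
      (⨆ x : EuclideanSpace ℝ (Fin d), ⟪φ x, Rp β (φ x)⟫) ^ 2)
    (hcfin : IntegrableOn
      (fun β => (⨆ x : EuclideanSpace ℝ (Fin d), ⟪φ x, Rp β (φ x)⟫) ^ 2)
      (Set.Ioi (0 : ℝ)))
    (vpop : ℝ) (hvpop : IsKKLa φ α p q vpop)
    (V : (Fin n → EuclideanSpace ℝ (Fin d)) → (Fin m → EuclideanSpace ℝ (Fin d)) → ℝ)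
    (hV : ∀ xs ys, IsKKLa φ α (empMeas xs) (empMeas ys) (V xs ys)) :
    ∫⁻ ω : (Fin n → EuclideanSpace ℝ (Fin d)) × (Fin m → EuclideanSpace ℝ (Fin d)),
        ENNReal.ofReal |V ω.1 ω.2 - vpop|
        ∂((Measure.pi fun _ : Fin n => p).prod (Measure.pi fun _ : Fin m => q))
      ≤ ENNReal.ofReal
          (32 / (α * Real.sqrt (min m n : ℕ)) * (2 * Real.sqrt c + Real.log n)
            + (2 / (min m n : ℕ))
              * (1 / α + c * (26 * Real.log n) ^ 2 / α ^ 2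
                  * (1 + (n : ℝ) / (min m n : ℕ)))) := by
  have hφ1 : ∀ x, ‖φ x‖ = 1 := fun x => by
    have h := hk1 x
    rw [hk, real_inner_self_eq_norm_sq] at h
    nlinarith [norm_nonneg (φ x)]
  have h0 : 0 < α := hα.1
  have h1 : α ≤ 1 := hα.2.le
  have hmn : 0 < min m n := lt_min hm hn
  have hkk : (0 : ℝ) < (min m n : ℕ) := by exact_mod_cast hmn
  set κ : ℝ := ((min m n : ℕ) : ℝ) with hκ
  set μ := (Measure.pi fun _ : Fin n => p).prod (Measure.pi fun _ : Fin m => q) with hμ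
  have hS : Smp μ p q (Prod.fst : (Fin n → EuclideanSpace ℝ (Fin d)) ×
      (Fin m → EuclideanSpace ℝ (Fin d)) → _) Prod.snd κ :=
    { hn := hn, hm := hm, cx := continuous_fst, cy := continuous_snd
      px := measurePreserving_fst, py := measurePreserving_snd, hk := hkk
      kn := by rw [hκ]; exact_mod_cast min_le_right m n
      km := by rw [hκ]; exact_mod_cast min_le_left m n }
  obtain ⟨iv, ev⟩ := kkl_formula p q hφc hφ1 h0 h1 hvpop
  obtain ⟨ι, f, lam, g, gam, hf, hlam, hg, hgam, -, -⟩ := hvpop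
  have hc0 : 0 < c := hc ▸ c_pos hφc hφ1 hRp hcfin
  have m1 : ∀ P Q : Measure (EuclideanSpace ℝ (Fin d)), mix φ 1 P Q = covOp φ P := fun P Q => by
    simp [mix]
  have b1 := main_S hS hφc hφ1 h0 h1 f hf hlam g hg hgam hRp hc hcfin
  have b2 := main_S hS hφc hφ1 one_pos le_rfl f hf hlam f (fun j => by rw [m1]; exact hf j) hlam
    hRp hc hcfin
  have hm1 := (T_meas hS hφc hφ1 h0 h1).lintegral_prod_right'
  simp only [m1] at b2
  have hpt : ∀ ω : (Fin n → EuclideanSpace ℝ (Fin d)) × (Fin m → EuclideanSpace ℝ (Fin d)),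
      ENNReal.ofReal |V ω.1 ω.2 - vpop| ≤
      (∫⁻ β in Set.Ioi (0 : ℝ), ENNReal.ofReal
        |tr φ (empMeas ω.1) (rs (mix φ α (empMeas ω.1) (empMeas ω.2)) β)
        - tr φ p (rs (mix φ α p q) β)|)
      + ∫⁻ β in Set.Ioi (0 : ℝ), ENNReal.ofReal
        |tr φ (empMeas ω.1) (rs (covOp φ (empMeas ω.1)) β) - tr φ p (rs (covOp φ p) β)| := by
    intro ω
    have := empMeas_prob hn ω.1
    have := empMeas_prob hm ω.2
    obtain ⟨iV, eV⟩ := kkl_formula (empMeas ω.1) (empMeas ω.2) hφc hφ1 h0 h1 (hV ω.1 ω.2)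
    have hM := mix_psd p q hφc hφ1 h0.le h1
    have hM' := mix_psd (empMeas ω.1) (empMeas ω.2) hφc hφ1 h0.le h1
    have cc : ContinuousOn (fun β => tr φ (empMeas ω.1)
        (rs (mix φ α (empMeas ω.1) (empMeas ω.2)) β) - tr φ p (rs (mix φ α p q) β))
        (Set.Ioi 0) :=
      ((tr_continuous (empMeas ω.1) hφc hφ1).comp_continuousOn (rs_continuousOn' hM')).sub
        ((tr_continuous p hφc hφ1).comp_continuousOn (rs_continuousOn' hM))
    have am := (cc.abs.aemeasurable (μ := volume) measurableSet_Ioi).ennreal_ofReal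
    rw [← lintegral_add_left' am, eV, ev, ← integral_sub iV iv, ← Real.enorm_eq_ofReal_abs]
    refine (enorm_integral_le_lintegral_enorm _).trans (lintegral_mono fun β => ?_)
    rw [Real.enorm_eq_ofReal_abs, ← ENNReal.ofReal_add (abs_nonneg _) (abs_nonneg _)]
    apply ENNReal.ofReal_le_ofReal
    refine le_trans (le_of_eq ?_) (abs_sub _ _)
    congr 1
    ring
  refine (lintegral_mono hpt).trans ?_
  rw [lintegral_add_left' hm1]
  refine (add_le_add b1 b2).trans ?_
  rw [← ENNReal.ofReal_add (by positivity) (by positivity)]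
  apply ENNReal.ofReal_le_ofReal
  have hlog : 0 ≤ Real.log n := Real.log_natCast_nonneg n
  have hsk : 0 < √κ := Real.sqrt_pos.2 hkk
  have r1 : 32 * (√c / (1 * √κ)) ≤ 32 * (√c / (α * √κ)) := by gcongr
  have r2 : 32 / (α * √κ) * (2 * √c + Real.log n)
      = 64 * (√c / (α * √κ)) + 32 / (α * √κ) * Real.log n := by ring
  have r3 : 0 ≤ 32 / (α * √κ) * Real.log n := by positivity
  have r4 : 0 ≤ 2 / κ * (1 / α + c * (26 * Real.log n) ^ 2 / α ^ 2 * (1 + (n : ℝ) / κ)) := by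
    positivity
  rw [r2]
  linarith
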